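/- arXiv:1504.04195 — 2 statements merged into one kernel-verified Lean document; each statement's English description precedes it below -/
import Mathlib

section
/- Let G be a 2-connected claw-free graph on n ≥ 219 vertices. If μ(Ḡ) ≤ μ(the complement of EP'_n), where Ḡ is the complement of G, then G is Hamiltonian, unless G is isomorphic to EP'_n. -/
open SimpleGraph

/-- A graph is claw-free if it contains no induced `K_{1,3}`. -/
def ClawFree {V : Type*} (G : SimpleGraph V) : Prop :=
  ¬ ∃ v a b c : V, a ≠ b ∧ a ≠ c ∧ b ≠ c ∧
    G.Adj v a ∧ G.Adj v b ∧ G.Adj v c ∧ ¬ G.Adj a b ∧ ¬ G.Adj a c ∧ ¬ G.Adj b c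

/-- A graph is traceable if it has a Hamilton path. -/
def Traceable {V : Type*} (G : SimpleGraph V) : Prop := by
  classical
  exact ∃ (u v : V) (p : G.Walk u v), p.IsHamiltonian

/-- A graph is 2-connected if it has at least 3 vertices and deleting any
single vertex leaves a connected graph. -/
def TwoConnected {V : Type*} [Fintype V] [DecidableEq V] (G : SimpleGraph V) : Prop :=
  3 ≤ Fintype.card V ∧ ∀ v : V, (G.induce ({v}ᶜ : Set V)).Connected

/-- A vertex is eligible if its neighbourhood induces a connected non-complete graph. -/
def Eligible {V : Type*} (G : SimpleGraph V) (x : V) : Prop :=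
  (G.induce (G.neighborSet x)).Connected ∧
    ∃ u v : V, G.Adj x u ∧ G.Adj x v ∧ u ≠ v ∧ ¬ G.Adj u v

/-- A claw-free graph is closed if it has no eligible vertex. -/
def IsClosedGraph {V : Type*} (G : SimpleGraph V) : Prop := ∀ x : V, ¬ Eligible G x

/-- The spectral radius of a graph: the largest eigenvalue of its adjacency matrix. -/
noncomputable def adjSpectralRadius {V : Type*} [Fintype V] [DecidableEq V] (G : SimpleGraph V) : ℝ := by
  classical
  exact sSup {μ : ℝ | ∃ x : V → ℝ, x ≠ 0 ∧ (G.adjMatrix ℝ).mulVec x = μ • x}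

/-- The `Q`-index of a graph: the largest eigenvalue of `Q = D + A`. -/
noncomputable def qIndex {V : Type*} [Fintype V] [DecidableEq V] (G : SimpleGraph V) : ℝ := by
  classical
  exact sSup {μ : ℝ | ∃ x : V → ℝ, x ≠ 0 ∧
    (Matrix.diagonal (fun v => (G.degree v : ℝ)) + G.adjMatrix ℝ).mulVec x = μ • x}

/-- `EN n`: the complete graph on `{0, …, n-4}` together with pendant vertices
`n-3, n-2, n-1` attached to `0, 1, 2` respectively. -/
def ENgraph (n : ℕ) : SimpleGraph (Fin n) :=
  SimpleGraph.fromRel (fun i j =>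
    (i.val < n - 3 ∧ j.val < n - 3) ∨ j.val = i.val + (n - 3))

/-- `EP n`: a clique on `{0,…,n-7}` with `a_i = i`, a triangle `b_i = n-6+i`,
and vertices `c_i = n-3+i` with edges `a_i b_i`, `a_i c_i`, `b_i c_i` (`i = 0,1,2`). -/
def EPgraph (n : ℕ) : SimpleGraph (Fin n) :=
  SimpleGraph.fromRel (fun i j =>
    (i.val < n - 6 ∧ j.val < n - 6) ∨
    (n - 6 ≤ i.val ∧ i.val < n - 3 ∧ n - 6 ≤ j.val ∧ j.val < n - 3) ∨
    (i.val < 3 ∧ (j.val = i.val + (n - 6) ∨ j.val = i.val + (n - 3))) ∨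
    (n - 6 ≤ i.val ∧ i.val < n - 3 ∧ j.val = i.val + 3))

/-- `EP' n`: a clique on `{0,…,n-7}` with `a₁ = 0`, `b₁ = 1`, `c₁ = 2`, triangles
`a₁a₂a₃` and `b₁b₂b₃` where `a₂ = n-6`, `a₃ = n-5`, `b₂ = n-4`, `b₃ = n-3`, and
vertices `c₂ = n-2`, `c₃ = n-1` with edges `a_i b_i`, `a_i c_i`, `b_i c_i` for `i = 2,3`. -/
def EP'graph (n : ℕ) : SimpleGraph (Fin n) :=
  SimpleGraph.fromRel (fun i j =>
    (i.val < n - 6 ∧ j.val < n - 6) ∨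
    (i.val = 0 ∧ (j.val = n - 6 ∨ j.val = n - 5)) ∨
    (i.val = 1 ∧ (j.val = n - 4 ∨ j.val = n - 3)) ∨
    (i.val = n - 6 ∧ (j.val = n - 5 ∨ j.val = n - 4 ∨ j.val = n - 2)) ∨
    (i.val = n - 5 ∧ (j.val = n - 3 ∨ j.val = n - 1)) ∨
    (i.val = n - 4 ∧ (j.val = n - 3 ∨ j.val = n - 2)) ∨
    (i.val = n - 3 ∧ j.val = n - 1))

section Cycles

variable {V : Type*}

/-- A list of distinct vertices which are cyclically adjacent. -/
def CycList (H : SimpleGraph V) (l : List V) : Prop :=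
  l.Nodup ∧ (l ++ l.head?.toList).IsChain H.Adj

/-- A cyclic list through all the vertices. -/
def HamList (H : SimpleGraph V) : Prop := ∃ l, CycList H l ∧ ∀ v, v ∈ l

variable {H : SimpleGraph V}

lemma cycList_cons {x : V} {t : List V} :
    CycList H (x :: t) ↔ (x :: t).Nodup ∧ (x :: t ++ [x]).IsChain H.Adj := by
  simp [CycList]

lemma isChain_reverse_adj {l : List V} : l.reverse.IsChain H.Adj ↔ l.IsChain H.Adj := by
  rw [List.isChain_reverse]
  simp only [H.adj_comm]
  
lemma CycList.rotate {x y : V} {A B : List V} (h : CycList H (x :: A ++ y :: B)) :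
    CycList H (y :: B ++ x :: A) := by
  rw [List.cons_append, cycList_cons] at *
  refine ⟨by grind, ?_⟩
  have h2 := h.2
  have e : x :: (A ++ y :: B) ++ [x] = (x :: A) ++ y :: (B ++ [x]) := by simp
  have e' : y :: (B ++ x :: A) ++ [y] = (y :: B) ++ x :: (A ++ [y]) := by simp
  rw [e, List.isChain_split] at h2
  rw [e', List.isChain_split]
  simpa using h2.symm

lemma CycList.mono {H' : SimpleGraph V} (hle : H ≤ H') {l : List V} (h : CycList H l) :
    CycList H' l := ⟨h.1, h.2.imp fun _ _ hab => hle hab⟩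

lemma HamList.mono {H' : SimpleGraph V} (hle : H ≤ H') (h : HamList H) : HamList H' := by
  obtain ⟨l, hl, h⟩ := h
  exact ⟨l, hl.mono hle, h⟩

lemma exists_walk_support_eq {u v : V} {t : List V} (h : (u :: t).IsChain H.Adj)
    (hv : (u :: t).getLast? = some v) : ∃ p : H.Walk u v, p.support = u :: t := by
  induction t generalizing u with
  | nil =>
    obtain rfl : u = v := by simpa using hv
    exact ⟨.nil, rfl⟩
  | cons w t ih =>
    obtain ⟨p, hp⟩ := ih h.of_cons (by simpa using hv)
    exact ⟨.cons h.rel p, by rw [Walk.support_cons, hp]⟩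

lemma HamList.isHamiltonian [Fintype V] [DecidableEq V] (h : HamList H)
    (hcard : 3 ≤ Fintype.card V) : H.IsHamiltonian := by
  obtain ⟨l, hl, hmem⟩ := h
  have hlen : Fintype.card V = l.length := by
    rw [← List.toFinset_card_of_nodup hl.1, ← Finset.card_univ]
    congr 1
    ext v
    simp [hmem v]
  match l, hl, hmem, hlen with
  | [], _, _, h => simp at h; omega
  | [_], _, _, h => simp at h; omega
  | [_, _], _, _, h => simp at h; omega
  | x :: y :: z :: r, hl, hmem, hlen =>
    rw [cycList_cons] at hl
    obtain ⟨hnd, hch⟩ := hl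
    intro _
    have hxy : H.Adj x y := hch.rel
    have hyz : H.Adj y z := hch.of_cons.rel
    have hch' : (z :: (r ++ [x])).IsChain H.Adj := hch.of_cons.of_cons
    obtain ⟨p, hp⟩ := exists_walk_support_eq (t := r ++ [x]) hch' (v := x)
      (by rw [← List.cons_append, List.getLast?_concat])
    have hq : (Walk.cons hyz p).support = y :: z :: (r ++ [x]) := by
      rw [Walk.support_cons, hp]
    have hcyc : (Walk.cons hxy (Walk.cons hyz p)).IsCycle := by
      rw [Walk.cons_isCycle_iff, Walk.isPath_def, hq]
      refine ⟨by grind, fun he => ?_⟩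
      rw [Walk.edges_cons, List.mem_cons] at he
      rcases he with he | he
      · rw [Sym2.eq_iff] at he
        grind
      · have := p.snd_mem_support_of_mem_edges he
        rw [hp] at this
        grind
    refine ⟨x, _, (Walk.isHamiltonianCycle_iff_isCycle_and_support_count_tail_eq_one).2
      ⟨hcyc, fun v => ?_⟩⟩
    rw [Walk.support_cons, hq]
    exact List.count_eq_one_of_mem (by grind) (by have := hmem v; grind)

end Cycles

section Detours

variable {V : Type*} {H : SimpleGraph V} {K : Set V}

lemma nodup_of_count_le {l l' : List V} (h : l'.Nodup)
    (hc : ∀ (_ : DecidableEq V) c, l.count c ≤ l'.count c) : l.Nodup := by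
  classical
  exact List.nodup_iff_count_le_one.2 fun c =>
    (hc _ c).trans (List.nodup_iff_count_le_one.1 h c)

/-- A longest cycle `x A y B` through the set `K` together with a path `P` between `x` and `y`
which avoids the cycle. -/
structure Detour (H : SimpleGraph V) (K : Set V) (x : V) (A : List V) (y : V) (B P : List V) :
    Prop where
  nodup : (x :: A ++ y :: B ++ P).Nodup
  left : (x :: A ++ [y]).IsChain H.Adj
  right : (y :: B ++ [x]).IsChain H.Adj
  path : (x :: P ++ [y]).IsChain H.Adj
  path_ne : P ≠ []
  subset : ∀ k ∈ K, k ∈ x :: A ++ y :: B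
  maximal : ∀ l, CycList H l → (∀ k ∈ K, k ∈ l) → l.length ≤ A.length + B.length + 2

namespace Detour

variable {x y : V} {A B P : List V}

lemma swap (h : Detour H K x A y B P) : Detour H K y B x A P.reverse where
  nodup := nodup_of_count_le h.nodup fun _ c => by simp [List.count_cons]; omega
  left := h.right
  right := h.left
  path := by
    rw [← isChain_reverse_adj]
    simpa using h.path
  path_ne := by simpa using h.path_ne
  subset k hk := by have := h.subset k hk; grind
  maximal l hl hk := by have := h.maximal l hl hk; omega

lemma flip (h : Detour H K x A y B P) : Detour H K x B.reverse y A.reverse P where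
  nodup := nodup_of_count_le h.nodup fun _ c => by simp [List.count_cons]; omega
  left := by
    rw [← isChain_reverse_adj]
    simpa using h.right
  right := by
    rw [← isChain_reverse_adj]
    simpa using h.left
  path := h.path
  path_ne := h.path_ne
  subset k hk := by have := h.subset k hk; grind
  maximal l hl hk := by have := h.maximal l hl hk; simp; omega

lemma absurd_of_isChain (h : Detour H K x A y B P) {t : List V} (ht : (x :: t ++ [x]).IsChain H.Adj)
    (hnd : (x :: t).Nodup) (hsub : ∀ v ∈ A ++ y :: B, v ∈ t)
    (hlen : A.length + B.length + 1 < t.length) : False := by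
  have := h.maximal (x :: t) (cycList_cons.2 ⟨hnd, ht⟩) fun k hk => by
    have := h.subset k hk
    grind
  simp at this
  omega

lemma isChain_path_append (h : Detour H K x A y B P) {T : List V}
    (hT : (y :: T).IsChain H.Adj) : (x :: P ++ y :: T).IsChain H.Adj :=
  List.isChain_split.2 ⟨h.path, hT⟩

lemma left_ne (h : Detour H K x A y B P) : A ≠ [] := by
  rintro rfl
  have := List.length_pos_of_ne_nil h.path_ne
  have hnd := h.nodup
  refine h.absurd_of_isChain (t := P ++ y :: B) ?_
    (nodup_of_count_le hnd fun _ c => by simp [List.count_cons]; omega) (by grind) (by simp; omega)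
  simpa using h.isChain_path_append h.right

lemma right_ne (h : Detour H K x A y B P) : B ≠ [] := h.swap.left_ne

lemma not_adj_heads {a b : V} {A' B' : List V} (h : Detour H K x (a :: A') y (b :: B') P) :
    ¬ H.Adj a b := by
  intro hab
  have := List.length_pos_of_ne_nil h.path_ne
  have hnd := h.nodup
  refine h.absurd_of_isChain (t := P ++ y :: (a :: A').reverse ++ b :: B') ?_
    (nodup_of_count_le hnd fun _ c => by simp [List.count_cons]; omega) (by grind) (by simp; omega)
  have hl : (y :: (a :: A').reverse).IsChain H.Adj := by
    rw [← isChain_reverse_adj]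
    simpa using h.left.tail
  have hr := h.right.tail
  have : (y :: ((a :: A').reverse ++ b :: B' ++ [x])).IsChain H.Adj := by
    have : (y :: A'.reverse ++ a :: (b :: B' ++ [x])).IsChain H.Adj := by
      rw [List.isChain_split]
      refine ⟨by simpa using hl, ?_⟩
      exact List.IsChain.cons_cons hab (by simpa using hr)
    simpa using this
  simpa using h.isChain_path_append this

lemma not_adj_getLasts {a b : V} {A' B' : List V}
    (h : Detour H K x (A' ++ [a]) y (B' ++ [b]) P) : ¬ H.Adj a b := by
  have := h.flip
  simp only [List.reverse_append, List.reverse_singleton, List.singleton_append] at this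
  exact fun hab => this.not_adj_heads hab.symm

lemma not_adj_path_head {a p : V} {A' P' : List V} (h : Detour H K x (a :: A') y B (p :: P')) :
    ¬ H.Adj p a := by
  intro hpa
  have hnd := h.nodup
  refine h.absurd_of_isChain (t := p :: a :: A' ++ y :: B) ?_
    (nodup_of_count_le hnd fun _ c => by simp [List.count_cons]; omega) (by grind) (by simp; omega)
  have h1 : H.Adj x p := h.path.rel
  have : (a :: A' ++ y :: (B ++ [x])).IsChain H.Adj := by
    rw [List.isChain_split]
    exact ⟨h.left.tail, h.right⟩
  simpa [hpa, h1] using this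

/-- If the last vertex of `B` is adjacent to the last but one of `A`, the path can be inserted. -/
lemma not_adj_of_getLast {a' c b' : V} {A' B' : List V}
    (h : Detour H K x (A' ++ [c, a']) y (B' ++ [b']) P)
    (hb : ∀ b ∈ (B' ++ [b']).head?, H.Adj a' b) : ¬ H.Adj b' c := by
  intro hbc
  have := List.length_pos_of_ne_nil h.path_ne
  have hnd := h.nodup
  refine h.absurd_of_isChain (t := P ++ y :: a' :: (B' ++ [b']) ++ (A' ++ [c]).reverse) ?_
    (nodup_of_count_le hnd fun _ c => by simp [List.count_cons]; omega) (by grind) (by simp; omega)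
  have h1 : (y :: a' :: B' ++ [b']).IsChain H.Adj := by
    have hya : H.Adj y a' := by
      have := h.left
      rw [show x :: (A' ++ [c, a']) ++ [y] = (x :: A' ++ [c]) ++ a' :: [y] by simp,
        List.isChain_split] at this
      exact (this.2.rel).symm
    have hB : (B' ++ [b']).IsChain H.Adj := by
      have := h.right.tail
      simp only [List.tail_cons, List.cons_append] at this
      exact this.left_of_append
    exact List.IsChain.cons_cons hya (List.isChain_cons.2 ⟨hb, hB⟩)
  have h2 : (b' :: (A' ++ [c]).reverse ++ [x]).IsChain H.Adj := by
    have : (c :: (A'.reverse ++ [x])).IsChain H.Adj := by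
      rw [← isChain_reverse_adj]
      have := h.left
      rw [show x :: (A' ++ [c, a']) ++ [y] = (x :: A' ++ [c]) ++ [a', y] by simp] at this
      simpa using this.left_of_append
    simpa [hbc] using this
  have : (y :: a' :: B' ++ b' :: ((A' ++ [c]).reverse ++ [x])).IsChain H.Adj := by
    rw [List.isChain_split]
    exact ⟨h1, by simpa using h2⟩
  simpa using h.isChain_path_append this

end Detour

end Detours

section Structure

variable {V : Type*}

/-- `K` is a clique, the neighbours outside `K` of any vertex of `K` form a clique, there is no
claw, and at most six vertices lie outside `K`. -/
structure CliqueLike (H : SimpleGraph V) (K : Set V) : Prop where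
  clique : ∀ u ∈ K, ∀ v ∈ K, u ≠ v → H.Adj u v
  clean : ∀ k ∈ K, ∀ s ∉ K, ∀ t ∉ K, H.Adj k s → H.Adj k t → s ≠ t → H.Adj s t
  claw : ∀ v a b c, H.Adj v a → H.Adj v b → H.Adj v c → a ≠ b → a ≠ c → b ≠ c →
    H.Adj a b ∨ H.Adj a c ∨ H.Adj b c
  length_le : ∀ l : List V, l.Nodup → (∀ v ∈ l, v ∉ K) → l.length ≤ 6

/-- The skeleton of the graph `EP`: three triangles with corners `aᵢ ∈ K`, `bᵢ`, `cᵢ`, where the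
edges `aᵢ bᵢ` may be missing. -/
structure EPType (H : SimpleGraph V) (K : Set V) (a₁ a₂ a₃ b₁ b₂ b₃ c₁ c₂ c₃ : V) : Prop where
  nodup : [a₁, a₂, a₃, b₁, b₂, b₃, c₁, c₂, c₃].Nodup
  mem₁ : a₁ ∈ K
  mem₂ : a₂ ∈ K
  mem₃ : a₃ ∈ K
  notMem_iff : ∀ v, v ∉ K ↔ v ∈ [b₁, b₂, b₃, c₁, c₂, c₃]
  adj_ac₁ : H.Adj a₁ c₁
  adj_ac₂ : H.Adj a₂ c₂
  adj_ac₃ : H.Adj a₃ c₃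
  adj_bc₁ : H.Adj b₁ c₁
  adj_bc₂ : H.Adj b₂ c₂
  adj_bc₃ : H.Adj b₃ c₃
  adj_b₁₂ : H.Adj b₁ b₂
  adj_b₁₃ : H.Adj b₁ b₃
  adj_b₂₃ : H.Adj b₂ b₃

/-- The skeleton of the graph `EP'`, where the edges `a₂ b₂` and `a₃ b₃` may be missing. -/
structure EP'Type (H : SimpleGraph V) (K : Set V) (a₁ a₂ a₃ b₁ b₂ b₃ c₂ c₃ : V) : Prop where
  nodup : [a₁, b₁, a₂, a₃, b₂, b₃, c₂, c₃].Nodup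
  mem_a : a₁ ∈ K
  mem_b : b₁ ∈ K
  notMem_iff : ∀ v, v ∉ K ↔ v ∈ [a₂, a₃, b₂, b₃, c₂, c₃]
  adj_a₁₂ : H.Adj a₁ a₂
  adj_a₁₃ : H.Adj a₁ a₃
  adj_a₂₃ : H.Adj a₂ a₃
  adj_b₁₂ : H.Adj b₁ b₂
  adj_b₁₃ : H.Adj b₁ b₃
  adj_b₂₃ : H.Adj b₂ b₃
  adj_ac₂ : H.Adj a₂ c₂
  adj_ac₃ : H.Adj a₃ c₃
  adj_bc₂ : H.Adj b₂ c₂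
  adj_bc₃ : H.Adj b₃ c₃

variable {H : SimpleGraph V} {K : Set V}

lemma exists_split_of_mem {A : List V} (h : ∃ k ∈ A, k ∈ K) :
    ∃ L k T, A = L ++ k :: T ∧ k ∈ K ∧ ∀ v ∈ L, v ∉ K := by
  induction A with
  | nil => simp at h
  | cons a A ih =>
    by_cases ha : a ∈ K
    · exact ⟨[], a, A, rfl, ha, by simp⟩
    · obtain ⟨L, k, T, rfl, hk, hL⟩ := ih (by grind)
      exact ⟨a :: L, k, T, rfl, hk, by grind⟩

lemma exists_runs_of_mem {A : List V} (h : ∃ k ∈ A, k ∈ K) :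
    ∃ L M R, A = L ++ M ++ R ∧ (∀ v ∈ L, v ∉ K) ∧ (∀ v ∈ R, v ∉ K) ∧
      (∃ k ∈ K, ∃ T, M = k :: T) ∧ ∃ k ∈ K, ∃ T, M = T ++ [k] := by
  obtain ⟨L, k, T, rfl, hk, hL⟩ := exists_split_of_mem h
  obtain ⟨R, k', M, hM, hk', hR⟩ := exists_split_of_mem (A := (k :: T).reverse) (K := K)
    ⟨k, by simp, hk⟩
  have hM' : k :: T = M.reverse ++ [k'] ++ R.reverse := by
    rw [← List.reverse_inj, hM]
    simp
  refine ⟨L, M.reverse ++ [k'], R.reverse, by rw [hM']; simp, hL, by simpa using hR, ?_,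
    k', hk', _, rfl⟩
  cases hMr : M.reverse with
  | nil => exact ⟨k', hk', [], by simp⟩
  | cons m M' =>
    rw [hMr] at hM'
    simp only [List.cons_append, List.cons.injEq] at hM'
    exact ⟨k, hk, M' ++ [k'], by simp [hM'.1]⟩

lemma CliqueLike.mem_of_length_eq (hK : CliqueLike H K) {l : List V} (hnd : l.Nodup)
    (hl : ∀ v ∈ l, v ∉ K) (h6 : 6 ≤ l.length) {v : V} (hv : v ∉ K) : v ∈ l := by
  by_contra hvl
  have := hK.length_le (v :: l) (by simp [hvl, hnd]) (by simpa [hv] using hl)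
  simp at this
  omega

namespace Detour

variable {x y : V} {A B P : List V}

lemma path_notMem (h : Detour H K x A y B P) {p : V} (hp : p ∈ P) : p ∉ K := by
  intro hpK
  have := h.subset p hpK
  have hnd := h.nodup
  rw [List.nodup_append] at hnd
  exact hnd.2.2 p this p hp rfl

lemma ne_head_getLast {a b : V} {A' B' : List V} (h : Detour H K x (a :: A') y (B' ++ [b]) P) :
    a ≠ b := by
  rintro rfl
  have hnd := h.nodup
  classical
  have := List.nodup_iff_count_le_one.1 hnd a
  simp [List.count_cons] at this
  omega

lemma adj_head_right {b : V} {B' : List V} (h : Detour H K x A y (B' ++ [b]) P) :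
    H.Adj x b := by
  have := h.right
  rw [show y :: (B' ++ [b]) ++ [x] = (y :: B') ++ b :: [x] by simp, List.isChain_split] at this
  exact this.2.rel.symm

lemma adj_head_left {a : V} {A' : List V} (h : Detour H K x (a :: A') y B P) : H.Adj x a :=
  h.left.rel

lemma exists_path_eq_cons (h : Detour H K x A y B P) : ∃ p P', P = p :: P' :=
  List.exists_cons_of_ne_nil h.path_ne

lemma adj_head_getLast (hK : CliqueLike H K) {a b : V} {A' B' : List V}
    (h : Detour H K x (a :: A') y (B' ++ [b]) P) : H.Adj a b := by
  obtain ⟨p, P', rfl⟩ := h.exists_path_eq_cons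
  have hf := h.flip
  simp only [List.reverse_append, List.reverse_singleton, List.singleton_append] at hf
  have hnd := h.nodup
  have hpa : a ≠ p := fun e => by
    classical
    have := List.nodup_iff_count_le_one.1 hnd a
    simp [List.count_cons, e] at this
    omega
  have hpb : b ≠ p := fun e => by
    classical
    have := List.nodup_iff_count_le_one.1 hnd b
    simp [List.count_cons, e] at this
    omega
  rcases hK.claw x a b p h.adj_head_left h.adj_head_right h.path.rel
    h.ne_head_getLast hpa hpb with h1 | h1 | h1
  · exact h1
  · exact absurd h1.symm h.not_adj_path_head
  · exact absurd h1.symm hf.not_adj_path_head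

lemma head_mem (hK : CliqueLike H K) {a : V} {A' : List V} (h : Detour H K x (a :: A') y B P)
    (hx : x ∈ K) : a ∈ K := by
  obtain ⟨p, P', rfl⟩ := h.exists_path_eq_cons
  by_contra ha
  have hp : p ∉ K := h.path_notMem (by simp)
  have hnd := h.nodup
  refine h.not_adj_path_head (hK.clean x hx p hp a ha h.path.rel h.adj_head_left fun e => ?_)
  classical
  have := List.nodup_iff_count_le_one.1 hnd a
  simp [List.count_cons, e] at this
  omega

/-- If `B` ends in `K`, then `A` does not end in a run of length one outside `K`. -/
lemma not_mem_of_getLast (hK : CliqueLike H K) {a' c b' : V} {A' B' : List V}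
    (h : Detour H K x (A' ++ [c, a']) y (B' ++ [b']) P) (hb : b' ∈ K) : c ∉ K := by
  intro hc
  have hnd := h.nodup
  refine h.not_adj_of_getLast (fun b hb => ?_) (hK.clique _ hb _ hc fun e => ?_)
  · obtain ⟨b₀, B₀, hB⟩ := List.exists_cons_of_ne_nil h.right_ne
    rw [hB] at h hb
    obtain rfl : b₀ = b := by simpa using hb
    have h' : Detour H K x ((A' ++ [c]) ++ [a']) y (b₀ :: B₀) P := by simpa using h
    exact (h'.swap.adj_head_getLast hK).symm
  · classical
    have := List.nodup_iff_count_le_one.1 hnd c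
    simp [List.count_cons, e] at this
    omega

end Detour

end Structure

section Types

variable {V : Type*} {H : SimpleGraph V} {K : Set V}

namespace Detour

variable {x y : V} {A B P : List V}

lemma not_mem_getLasts (hK : CliqueLike H K) {a b : V} {A' B' : List V}
    (h : Detour H K x (A' ++ [a]) y (B' ++ [b]) P) (ha : a ∈ K) : b ∉ K := by
  intro hb
  have hnd := h.nodup
  refine h.not_adj_getLasts (hK.clique _ ha _ hb fun e => ?_)
  classical
  have := List.nodup_iff_count_le_one.1 hnd a
  simp [List.count_cons, e] at this
  omega

lemma getLast_mem (hK : CliqueLike H K) {b : V} {B' : List V}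
    (h : Detour H K x A y (B' ++ [b]) P) (hx : x ∈ K) : b ∈ K := by
  have hf := h.flip
  simp only [List.reverse_append, List.reverse_singleton, List.singleton_append] at hf
  exact hf.head_mem hK hx

lemma two_le_length_run (hK : CliqueLike H K) {A₁ A₂ B₁ B₂ : List V}
    (h : Detour H K x (A₁ ++ A₂) y (B₁ ++ B₂) P) (hA : ∃ k ∈ K, ∃ T, A₁ = T ++ [k])
    (hB : ∃ k ∈ K, ∃ T, B₁ = T ++ [k]) (hB₂ : B₂ = []) : 2 ≤ A₂.length := by
  obtain ⟨k, hk, T, rfl⟩ := hA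
  obtain ⟨k', hk', T', rfl⟩ := hB
  subst hB₂
  rw [List.append_nil] at h
  match A₂, h with
  | [], h =>
    rw [List.append_nil] at h
    exact absurd hk' (h.not_mem_getLasts hK hk)
  | [r], h =>
    rw [List.append_assoc] at h
    exact absurd hk (h.not_mem_of_getLast hK hk')
  | _ :: _ :: _, _ => simp

lemma epType_of_mem (hK : CliqueLike H K) {l r p a' b z₁ z₂ : V} {A' B' : List V}
    (h : Detour H K x (A' ++ [z₁, l, a']) y (b :: r :: z₂ :: B') [p])
    (hx : x ∈ K) (hz₁ : z₁ ∈ K) (hz₂ : z₂ ∈ K)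
    (hn : ∀ v ∈ [y, a', b, p, l, r], v ∉ K) : EPType H K x z₁ z₂ y a' b p l r where
  nodup := nodup_of_count_le h.nodup fun _ c => by simp [List.count_cons]; omega
  mem₁ := hx
  mem₂ := hz₁
  mem₃ := hz₂
  notMem_iff v := ⟨fun hv => hK.mem_of_length_eq
    (nodup_of_count_le h.nodup fun _ c => by simp [List.count_cons]; omega) hn (by simp) hv, hn v⟩
  adj_ac₁ := h.path.rel
  adj_bc₁ := by have := h.path; simp at this; exact this.2.symm
  adj_ac₂ := by
    have := h.left
    rw [show x :: (A' ++ [z₁, l, a']) ++ [y] = (x :: A') ++ z₁ :: [l, a', y] by simp,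
      List.isChain_split] at this
    exact this.2.rel
  adj_bc₂ := by
    have := h.left
    rw [show x :: (A' ++ [z₁, l, a']) ++ [y] = (x :: A') ++ z₁ :: [l, a', y] by simp,
      List.isChain_split] at this
    exact this.2.tail.rel.symm
  adj_ac₃ := h.right.tail.tail.rel.symm
  adj_bc₃ := h.right.tail.rel
  adj_b₁₂ := by
    have := h.left
    rw [show x :: (A' ++ [z₁, l, a']) ++ [y] = (x :: A') ++ z₁ :: [l, a', y] by simp,
      List.isChain_split] at this
    exact this.2.tail.tail.rel.symm
  adj_b₁₃ := h.right.rel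
  adj_b₂₃ := by
    have h' : Detour H K x ((A' ++ [z₁, l]) ++ [a']) y (b :: r :: z₂ :: B') [p] := by simpa using h
    exact (h'.swap.adj_head_getLast hK).symm

lemma exists_epType_of_runs (hK : CliqueLike H K) {LA MA RA LB MB RB : List V}
    (h : Detour H K x (LA ++ MA ++ RA) y (LB ++ MB ++ RB) P)
    (hLA : ∀ v ∈ LA, v ∉ K) (hRA : ∀ v ∈ RA, v ∉ K)
    (hLB : ∀ v ∈ LB, v ∉ K) (hRB : ∀ v ∈ RB, v ∉ K)
    (hA₁ : ∃ k ∈ K, ∃ T, MA = k :: T) (hA₂ : ∃ k ∈ K, ∃ T, MA = T ++ [k])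
    (hB₁ : ∃ k ∈ K, ∃ T, MB = k :: T) (hB₂ : ∃ k ∈ K, ∃ T, MB = T ++ [k])
    (hx : x ∈ K) (hRA2 : 2 ≤ RA.length) (hLB2 : 2 ≤ LB.length) (hy : y ∉ K) :
    ∃ a₁ a₂ a₃ b₁ b₂ b₃ c₁ c₂ c₃, EPType H K a₁ a₂ a₃ b₁ b₂ b₃ c₁ c₂ c₃ := by
  have hP := List.length_pos_of_ne_nil h.path_ne
  have hlen := hK.length_le (y :: P ++ LA ++ RA ++ LB ++ RB)
    (nodup_of_count_le h.nodup fun _ c => by simp [List.count_cons]; omega) (by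
      have := fun p hp => h.path_notMem (p := p) hp
      grind)
  simp only [List.length_append, List.length_cons] at hlen
  obtain rfl : LA = [] := List.eq_nil_of_length_eq_zero (by omega)
  obtain rfl : RB = [] := List.eq_nil_of_length_eq_zero (by omega)
  obtain ⟨p, rfl⟩ := List.length_eq_one_iff.1 (by omega : P.length = 1)
  obtain ⟨l, a', rfl⟩ := List.length_eq_two.1 (by omega : RA.length = 2)
  obtain ⟨b, r, rfl⟩ := List.length_eq_two.1 (by omega : LB.length = 2)
  obtain ⟨z₁, hz₁, T₁, rfl⟩ := hA₂
  obtain ⟨z₂, hz₂, T₂, rfl⟩ := hB₁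
  have hp : p ∉ K := h.path_notMem (by simp)
  simp only [List.nil_append, List.append_assoc, List.append_nil, List.cons_append] at h
  exact ⟨_, _, _, _, _, _, _, _, _, h.epType_of_mem hK hx hz₁ hz₂ (by simp_all)⟩

/-- If both arcs meet `K`, the graph has the shape of `EP`. -/
lemma exists_epType (hK : CliqueLike H K) (h : Detour H K x A y B P)
    (hA : ∃ k ∈ A, k ∈ K) (hB : ∃ k ∈ B, k ∈ K) :
    ∃ a₁ a₂ a₃ b₁ b₂ b₃ c₁ c₂ c₃, EPType H K a₁ a₂ a₃ b₁ b₂ b₃ c₁ c₂ c₃ := by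
  obtain ⟨LA, MA, RA, rfl, hLA, hRA, hA₁, hA₂⟩ := exists_runs_of_mem hA
  obtain ⟨LB, MB, RB, rfl, hLB, hRB, hB₁, hB₂⟩ := exists_runs_of_mem hB
  have hl : ∀ {L M : List V}, (∃ k ∈ K, ∃ T, M = k :: T) →
      ∃ k ∈ K, ∃ T, M.reverse ++ L = T ++ [k] ++ L := by
    rintro L M ⟨k, hk, T, rfl⟩
    exact ⟨k, hk, T.reverse, by simp⟩
  have hL : ∀ {L M : List V}, (∃ k ∈ K, ∃ T, M = T ++ [k]) → ∃ k ∈ K, ∃ T, L ++ M = T ++ [k] := by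
    rintro L M ⟨k, hk, T, rfl⟩
    exact ⟨k, hk, L ++ T, by simp⟩
  have hR : ∀ {L M : List V}, (∃ k ∈ K, ∃ T, M = k :: T) →
      ∃ k ∈ K, ∃ T, L.reverse ++ M.reverse = T ++ [k] := by
    rintro L M ⟨k, hk, T, rfl⟩
    exact ⟨k, hk, L.reverse ++ T.reverse, by simp⟩
  have hf := h.flip
  simp only [List.reverse_append] at hf
  rw [← List.append_assoc, ← List.append_assoc] at hf
  have f1 := h.two_le_length_run hK (hL hA₂) (hL hB₂)
  have f2 := h.swap.two_le_length_run hK (hL hB₂) (hL hA₂)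
  have f3 := hf.two_le_length_run hK (hR hB₁) (hR hA₁)
  have f4 := hf.swap.two_le_length_run hK (hR hA₁) (hR hB₁)
  simp only [List.length_reverse, List.reverse_eq_nil_iff] at f3 f4
  have hxx : x ∈ K → LA = [] ∧ RB = [] := by
    intro hx
    constructor
    · cases LA with
      | nil => rfl
      | cons a LA => exact absurd (h.head_mem hK hx) (hLA a (by simp))
    · rcases List.eq_nil_or_concat RB with rfl | ⟨RB, b, rfl⟩
      · rfl
      · rw [List.concat_eq_append, ← List.append_assoc] at h
        exact absurd (h.getLast_mem hK hx) (hRB b (by simp))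
  have hyy : y ∈ K → LB = [] ∧ RA = [] := by
    intro hx
    constructor
    · cases LB with
      | nil => rfl
      | cons a LB => exact absurd (h.swap.head_mem hK hx) (hLB a (by simp))
    · rcases List.eq_nil_or_concat RA with rfl | ⟨RA, b, rfl⟩
      · rfl
      · rw [List.concat_eq_append, ← List.append_assoc] at h
        exact absurd (h.swap.getLast_mem hK hx) (hRA b (by simp))
  by_cases hx : x ∈ K
  · by_cases hy : y ∈ K
    · have := f4 (hyy hy).1
      simp [(hxx hx).1] at this
    · exact exists_epType_of_runs hK h hLA hRA hLB hRB hA₁ hA₂ hB₁ hB₂ hx (f1 (hxx hx).2)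
        (f3 (hxx hx).1) hy
  · by_cases hy : y ∈ K
    · exact exists_epType_of_runs hK h.swap hLB hRB hLA hRA hB₁ hB₂ hA₁ hA₂ hy (f2 (hyy hy).2)
        (f4 (hyy hy).1) hx
    · have hP := List.length_pos_of_ne_nil h.path_ne
      have hlen := hK.length_le (x :: y :: P ++ LA ++ RA ++ LB ++ RB)
        (nodup_of_count_le h.nodup fun _ c => by simp [List.count_cons]; omega) (by
          have := fun p hp => h.path_notMem (p := p) hp
          grind)
      simp only [List.length_append, List.length_cons] at hlen
      have e : ∀ l : List V, l = [] ↔ l.length = 0 := fun l => List.length_eq_zero_iff.symm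
      simp only [e] at f1 f2 f3 f4
      omega

/-- If an arc avoids `K`, the graph has the shape of `EP'`. -/
lemma exists_ep'Type (hK : CliqueLike H K) (h : Detour H K x A y B P)
    (hA : ∀ v ∈ A, v ∉ K) (hK2 : ∃ u ∈ K, ∃ v ∈ K, u ≠ v) :
    ∃ a₁ a₂ a₃ b₁ b₂ b₃ c₂ c₃, EP'Type H K a₁ a₂ a₃ b₁ b₂ b₃ c₂ c₃ := by
  have hP := List.length_pos_of_ne_nil h.path_ne
  have hnd := h.nodup
  obtain ⟨b', B', hB'⟩ : ∃ b' B', B = B' ++ [b'] := by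
    rcases List.eq_nil_or_concat B with hB | ⟨B', b', hB⟩
    · exact absurd hB h.right_ne
    · exact ⟨b', B', by simpa using hB⟩
  obtain ⟨m₁, A', rfl⟩ := List.exists_cons_of_ne_nil h.left_ne
  have hx : x ∉ K := fun hx => hA m₁ (by simp) (h.head_mem hK hx)
  have hy : y ∉ K := by
    intro hy
    rcases List.eq_nil_or_concat (m₁ :: A') with hB | ⟨T, t, hB⟩
    · simp at hB
    · rw [List.concat_eq_append] at hB
      refine hA t (by simp [hB]) ?_
      rw [hB] at h
      exact h.swap.getLast_mem hK hy
  have hm₁b' : H.Adj m₁ b' := by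
    subst hB'
    exact h.adj_head_getLast hK
  have hlen := hK.length_le (x :: y :: P ++ m₁ :: A')
    (nodup_of_count_le h.nodup fun _ c => by simp [List.count_cons]; omega) (by
      have := fun p hp => h.path_notMem (p := p) hp
      grind)
  simp only [List.length_append, List.length_cons] at hlen
  match A', h, hA, hlen, hnd with
  | [], h, hA, hlen, hnd =>
    exfalso
    refine h.absurd_of_isChain (t := P ++ y :: B ++ [m₁])  ?_
      (nodup_of_count_le hnd fun _ c => by simp [List.count_cons]; omega) (by simp; tauto)
      (by simp; omega)
    have h1 : (y :: (B ++ [m₁] ++ [x])).IsChain H.Adj := by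
      subst hB'
      have := h.right
      rw [show y :: (B' ++ [b']) ++ [x] = (y :: B') ++ b' :: [x] by simp, List.isChain_split]
        at this
      rw [show y :: (B' ++ [b'] ++ [m₁] ++ [x]) = (y :: B') ++ b' :: [m₁, x] by simp,
        List.isChain_split]
      refine ⟨this.1, ?_⟩
      simp [hm₁b'.symm, h.adj_head_left.symm]
    simpa using h.isChain_path_append h1
  | [a'], h, hA, hlen, hnd =>
    exfalso
    subst hB'
    refine h.not_adj_of_getLast (A' := []) (fun b hb => ?_) hm₁b'.symm
    obtain ⟨b₀, B₀, hB⟩ := List.exists_cons_of_ne_nil h.right_ne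
    rw [hB] at h hb
    obtain rfl : b₀ = b := by simpa using hb
    have h' : Detour H K x ([m₁] ++ [a']) y (b₀ :: B₀) P := by simpa using h
    exact (h'.swap.adj_head_getLast hK).symm
  | m₂ :: m₃ :: A'', h, hA, hlen, hnd =>
    simp only [List.length_cons] at hlen
    obtain rfl : A'' = [] := List.eq_nil_of_length_eq_zero (by omega)
    obtain ⟨p, rfl⟩ := List.length_eq_one_iff.1 (by omega : P.length = 1)
    have hp : p ∉ K := h.path_notMem (by simp)
    have hout : ∀ v, v ∉ K → v ∈ [x, m₁, y, m₃, p, m₂] := fun v hv =>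
      hK.mem_of_length_eq (nodup_of_count_le hnd fun _ c => by simp [List.count_cons]; omega)
        (by simp_all) (by simp) hv
    have hBK : ∀ b ∈ B, b ∈ K := by
      intro b hb
      by_contra hbK
      have := hout b hbK
      classical
      have h1 := List.nodup_iff_count_le_one.1 hnd b
      have h2 := List.count_pos_iff.2 hb
      have h3 := List.count_pos_iff.2 this
      simp [List.count_cons] at h1 h3
      omega
    obtain ⟨b, B'', rfl⟩ : ∃ b B'', B' = b :: B'' := by
      refine List.exists_cons_of_ne_nil ?_
      rintro rfl
      have : ∀ k ∈ K, k = b' := by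
        intro k hk
        have := h.subset k hk
        simp only [hB'] at this
        simp at this hA
        rcases this with rfl | rfl | rfl | rfl | rfl | rfl <;> tauto
      obtain ⟨u, hu, v, hv, huv⟩ := hK2
      exact huv ((this u hu).trans (this v hv).symm)
    subst hB'
    have h' : Detour H K x ([m₁, m₂] ++ [m₃]) y (b :: (B'' ++ [b'])) [p] := by simpa using h
    have hl := h.left
    simp only [List.cons_append, List.nil_append, List.isChain_cons_cons] at hl
    have hpath := h.path
    simp only [List.cons_append, List.nil_append, List.isChain_cons_cons] at hpath
    exact ⟨b', x, m₁, b, y, m₃, p, m₂, {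
      nodup := nodup_of_count_le hnd fun _ c => by simp [List.count_cons]; omega
      mem_a := hBK _ (by simp)
      mem_b := hBK _ (by simp)
      notMem_iff := fun v => ⟨hout v, by simp at hA ⊢; rintro (rfl|rfl|rfl|rfl|rfl|rfl) <;> tauto⟩
      adj_a₁₂ := h.adj_head_right.symm
      adj_a₁₃ := hm₁b'.symm
      adj_a₂₃ := hl.1
      adj_b₁₂ := h.swap.adj_head_left.symm
      adj_b₁₃ := h'.swap.adj_head_getLast hK
      adj_b₂₃ := hl.2.2.2.1.symm
      adj_ac₂ := hpath.1
      adj_ac₃ := hl.2.1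
      adj_bc₂ := hpath.2.1.symm
      adj_bc₃ := hl.2.2.1.symm }⟩

end Detour

end Types

section Existence

variable {V : Type*} {H : SimpleGraph V} {K : Set V}

lemma exists_isChain_of_isPath {s : Set V} {u v : s} (p : (H.induce s).Walk u v) (hp : p.IsPath)
    {C : Set V} (hu : (u : V) ∉ C) (hv : (v : V) ∈ C) :
    ∃ (P : List V) (y : V), ((u : V) :: P ++ [y]).IsChain H.Adj ∧ ((u : V) :: P).Nodup ∧
      (∀ w ∈ (u : V) :: P, w ∉ C) ∧ y ∈ C ∧ y ∈ s ∧
      ∀ w ∈ (u : V) :: P, ∃ w' ∈ p.support, (w' : V) = w := by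
  induction p with
  | nil => exact absurd hv hu
  | @cons u w v huw p ih =>
    rw [Walk.cons_isPath_iff] at hp
    by_cases hw : (w : V) ∈ C
    · refine ⟨[], w, ?_, by simp, by simpa using hu, hw, w.2, by simp⟩
      simpa using huw
    · obtain ⟨P, y, hch, hnd, hC, hy, hys, hsub⟩ := ih hp.1 hw hv
      refine ⟨w :: P, y, hch.cons_cons huw, List.nodup_cons.2 ⟨fun hmem => ?_, hnd⟩,
        List.forall_mem_cons.2 ⟨hu, hC⟩, hy, hys, List.forall_mem_cons.2 ⟨⟨u, by simp, rfl⟩, ?_⟩⟩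
      · obtain ⟨w', hw', he⟩ := hsub _ hmem
        exact hp.2 (Subtype.ext he ▸ hw')
      · intro z hz
        obtain ⟨w', hw', he⟩ := hsub z hz
        exact ⟨w', by simp [hw'], he⟩

lemma exists_isChain_of_connected {x : V} (hx : (H.induce ({x}ᶜ : Set V)).Connected) {C : Set V}
    {u v : V} (hux : u ≠ x) (hvx : v ≠ x) (hu : u ∉ C) (hv : v ∈ C) :
    ∃ (P : List V) (y : V), (u :: P ++ [y]).IsChain H.Adj ∧ (u :: P).Nodup ∧
      (∀ w ∈ u :: P, w ∉ C) ∧ y ∈ C ∧ y ≠ x := by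
  classical
  obtain ⟨p⟩ := hx.preconnected ⟨u, hux⟩ ⟨v, hvx⟩
  obtain ⟨P, y, h1, h2, h3, h4, h5, -⟩ := exists_isChain_of_isPath _ p.toPath.2 (C := C) hu hv
  exact ⟨P, y, h1, h2, h3, h4, h5⟩

lemma exists_adj_of_isChain {x y : V} {P : List V} (h : (x :: P ++ [y]).IsChain H.Adj) :
    ∃ q ∈ x :: P, H.Adj q y := by
  rcases List.eq_nil_or_concat (x :: P) with hP | ⟨T, q, hP⟩
  · simp at hP
  · rw [List.concat_eq_append] at hP
    rw [hP, List.append_assoc, List.singleton_append, List.isChain_split] at h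
    exact ⟨q, by simp [hP], h.2.rel⟩

lemma CycList.exists_rotate {l : List V} (h : CycList H l) {x y : V} (hx : x ∈ l) (hy : y ∈ l)
    (hxy : x ≠ y) : ∃ A B, CycList H (x :: A ++ y :: B) ∧ List.Perm (x :: A ++ y :: B) l := by
  obtain ⟨L, R, rfl⟩ := List.append_of_mem hx
  obtain ⟨T, hT, hp⟩ : ∃ T, CycList H (x :: T) ∧ List.Perm (x :: T) (L ++ x :: R) := by
    cases L with
    | nil => exact ⟨R, h, .refl _⟩
    | cons w L => exact ⟨R ++ w :: L, h.rotate, List.perm_append_comm (l₁ := x :: R)⟩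
  have hyT : y ∈ T := by
    have := hp.mem_iff.2 hy
    simpa [hxy.symm] using this
  obtain ⟨A, B, rfl⟩ := List.append_of_mem hyT
  exact ⟨A, B, hT, hp⟩

lemma exists_cycList_of_clique [Finite V] (hK : ∀ u ∈ K, ∀ v ∈ K, u ≠ v → H.Adj u v)
    (hK2 : ∃ u ∈ K, ∃ v ∈ K, u ≠ v) : ∃ l, CycList H l ∧ ∀ k ∈ K, k ∈ l := by
  classical
  obtain ⟨u, hu, v, hv, huv⟩ := hK2
  set r := ((Set.toFinite K).toFinset.erase u |>.erase v).toList with hr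
  have hmem : ∀ w, w ∈ r ↔ w ≠ v ∧ w ≠ u ∧ w ∈ K := by simp [hr]
  have hnd : (u :: r ++ [v]).Nodup := by
    have : r.Nodup := Finset.nodup_toList _
    simp only [List.cons_append, List.nodup_cons, List.nodup_append, List.mem_append, hmem]
    simp [this, huv]
    tauto
  refine ⟨u :: (r ++ [v]), cycList_cons.2 ⟨hnd, ?_⟩, fun k hk => ?_⟩
  · rw [show u :: (r ++ [v]) ++ [u] = u :: r ++ v :: [u] by simp, List.isChain_split]
    refine ⟨List.Pairwise.isChain (hnd.imp_of_mem fun ha hb hab => hK _ ?_ _ ?_ hab),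
      by simp [hK v hv u hu huv.symm]⟩ <;>
    · simp only [List.cons_append, List.mem_cons, List.mem_append, hmem, List.not_mem_nil] at ha hb
      grind
  · simp only [List.mem_cons, List.mem_append, hmem]
    tauto

lemma exists_detour [Finite V] (hconn : ∀ v, (H.induce ({v}ᶜ : Set V)).Connected)
    (hK : ∀ u ∈ K, ∀ v ∈ K, u ≠ v → H.Adj u v) (hK2 : ∃ u ∈ K, ∃ v ∈ K, u ≠ v)
    (hH : ¬ HamList H) : ∃ x A y B P, Detour H K x A y B P := by
  obtain ⟨l₀, hl₀, hK₀⟩ := exists_cycList_of_clique hK hK2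
  set S : Set ℕ := {m | ∃ l, CycList H l ∧ (∀ k ∈ K, k ∈ l) ∧ l.length = m}
  have hbdd : BddAbove S := by
    cases nonempty_fintype V
    refine ⟨Fintype.card V, ?_⟩
    rintro _ ⟨l, hl, -, rfl⟩
    exact hl.1.length_le_card
  obtain ⟨l, hl, hKl, hlen⟩ := Nat.sSup_mem (s := S) ⟨_, l₀, hl₀, hK₀, rfl⟩ hbdd
  have hmax : ∀ l', CycList H l' → (∀ k ∈ K, k ∈ l') → l'.length ≤ l.length := fun l' h1 h2 =>
    hlen ▸ le_csSup hbdd ⟨l', h1, h2, rfl⟩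
  obtain ⟨p, hp⟩ : ∃ p, p ∉ l := by
    by_contra! h
    exact hH ⟨l, hl, h⟩
  obtain ⟨u, hu, v, hv, huv⟩ := hK2
  have hul := hKl u hu
  have hvl := hKl v hv
  obtain ⟨P₀, x, hch, -, hP₀, hx, -⟩ := exists_isChain_of_connected (hconn u) (C := {w | w ∈ l})
    (u := p) (v := v) (fun e => hp (e ▸ hul)) huv.symm hp hvl
  obtain ⟨q, hq, hqx⟩ := exists_adj_of_isChain hch
  have hql := hP₀ q hq
  obtain ⟨w, hw, hwx⟩ : ∃ w ∈ l, w ≠ x := by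
    by_cases h : u = x
    · exact ⟨v, hvl, fun e => huv (h.trans e.symm)⟩
    · exact ⟨u, hul, h⟩
  obtain ⟨P, y, hch', hnd, hP, hy, hyx⟩ := exists_isChain_of_connected (hconn x)
    (C := {w | w ∈ l}) (u := q) (v := w) hqx.ne hwx hql hw
  obtain ⟨A, B, hAB, hperm⟩ := hl.exists_rotate hx hy hyx.symm
  have hAB' := hAB
  rw [List.cons_append, cycList_cons, show x :: (A ++ y :: B) ++ [x] = x :: A ++ y :: (B ++ [x])
    by simp, List.isChain_split] at hAB'
  refine ⟨x, A, y, B, q :: P, ?_, hAB'.2.1, hAB'.2.2, hch'.cons_cons hqx.symm, by simp,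
    fun k hk => hperm.mem_iff.2 (hKl k hk), fun l' h1 h2 => ?_⟩
  · exact List.nodup_append.2 ⟨hAB'.1, hnd, fun a ha b hb e =>
      hP b hb (hperm.mem_iff.1 (e ▸ ha))⟩
  · have := hperm.length_eq
    have := hmax l' h1 h2
    simp at *
    omega

end Existence

section Exclusion

variable {V : Type*} {H : SimpleGraph V} {K : Set V}

lemma hamList_of_isChain [Finite V] (hK : ∀ u ∈ K, ∀ v ∈ K, u ≠ v → H.Adj u v) {u v : V}
    (t : List V)
    (hu : u ∈ K) (hv : v ∈ K) (hnd : (u :: t ++ [v]).Nodup) (hch : (u :: t ++ [v]).IsChain H.Adj)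
    (hcov : ∀ w ∉ K, w ∈ u :: t ++ [v]) : HamList H := by
  classical
  set r := ((Set.toFinite K).toFinset \ (u :: t ++ [v]).toFinset).toList with hr
  have hmem : ∀ w, w ∈ r ↔ w ∈ K ∧ w ∉ u :: t ++ [v] := by simp [hr]; tauto
  have hrnd : r.Nodup := Finset.nodup_toList _
  have hnd' : (u :: t ++ v :: r).Nodup := by
    rw [show u :: t ++ v :: r = (u :: t ++ [v]) ++ r by simp, List.nodup_append]
    exact ⟨hnd, hrnd, fun a ha b hb e => ((hmem b).1 hb).2 (e ▸ ha)⟩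
  have huv : u ≠ v := by
    rintro rfl
    simp at hnd
  refine ⟨u :: (t ++ v :: r), cycList_cons.2 ⟨hnd', ?_⟩, fun w => ?_⟩
  · rw [show u :: (t ++ v :: r) ++ [u] = u :: t ++ v :: (r ++ [u]) by simp, List.isChain_split]
    refine ⟨hch, List.Pairwise.isChain ?_⟩
    have : (v :: (r ++ [u])).Nodup :=
      nodup_of_count_le hnd' fun _ c => by simp [List.count_cons]; omega
    refine this.imp_of_mem fun {a b} ha hb hab => hK _ ?_ _ ?_ hab <;>
    · simp only [List.mem_cons, List.mem_append, List.not_mem_nil, hmem] at ha hb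
      grind
  · by_cases hw : w ∈ u :: t ++ [v]
    · simp at hw ⊢
      tauto
    · have hwK : w ∈ K := by
        by_contra h
        exact hw (hcov w h)
      simp [hmem, hwK] at hw ⊢
      tauto

namespace EPType

variable {a₁ a₂ a₃ b₁ b₂ b₃ c₁ c₂ c₃ : V}

lemma swap₁₂ (h : EPType H K a₁ a₂ a₃ b₁ b₂ b₃ c₁ c₂ c₃) :
    EPType H K a₂ a₁ a₃ b₂ b₁ b₃ c₂ c₁ c₃ where
  nodup := nodup_of_count_le h.nodup fun _ c => by simp [List.count_cons]; omega
  mem₁ := h.mem₂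
  mem₂ := h.mem₁
  mem₃ := h.mem₃
  notMem_iff v := by
    rw [h.notMem_iff]
    simp
    tauto
  adj_ac₁ := h.adj_ac₂
  adj_ac₂ := h.adj_ac₁
  adj_ac₃ := h.adj_ac₃
  adj_bc₁ := h.adj_bc₂
  adj_bc₂ := h.adj_bc₁
  adj_bc₃ := h.adj_bc₃
  adj_b₁₂ := h.adj_b₁₂.symm
  adj_b₁₃ := h.adj_b₂₃
  adj_b₂₃ := h.adj_b₁₃

lemma swap₂₃ (h : EPType H K a₁ a₂ a₃ b₁ b₂ b₃ c₁ c₂ c₃) :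
    EPType H K a₁ a₃ a₂ b₁ b₃ b₂ c₁ c₃ c₂ where
  nodup := nodup_of_count_le h.nodup fun _ c => by simp [List.count_cons]; omega
  mem₁ := h.mem₁
  mem₂ := h.mem₃
  mem₃ := h.mem₂
  notMem_iff v := by
    rw [h.notMem_iff]
    simp
    tauto
  adj_ac₁ := h.adj_ac₁
  adj_ac₂ := h.adj_ac₃
  adj_ac₃ := h.adj_ac₂
  adj_bc₁ := h.adj_bc₁
  adj_bc₂ := h.adj_bc₃
  adj_bc₃ := h.adj_bc₂
  adj_b₁₂ := h.adj_b₁₃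
  adj_b₁₃ := h.adj_b₁₂
  adj_b₂₃ := h.adj_b₂₃.symm

lemma ne_of_mem (h : EPType H K a₁ a₂ a₃ b₁ b₂ b₃ c₁ c₂ c₃) {k v : V} (hk : k ∈ K)
    (hv : v ∈ [b₁, b₂, b₃, c₁, c₂, c₃]) : k ≠ v := fun e => (h.notMem_iff v).2 hv (e ▸ hk)

/-- A path between two vertices of `K` through the six vertices outside `K`. -/
lemma hamList [Finite V] (h : EPType H K a₁ a₂ a₃ b₁ b₂ b₃ c₁ c₂ c₃) (hK : CliqueLike H K) {u v : V}
    (t : List V) (hu : u ∈ K) (hv : v ∈ K) (hnd : (u :: t ++ [v]).Nodup)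
    (hch : (u :: t ++ [v]).IsChain H.Adj) (hcov : ∀ w ∈ [b₁, b₂, b₃, c₁, c₂, c₃], w ∈ t) :
    HamList H := by
  refine hamList_of_isChain hK.clique t hu hv hnd hch fun w hw => ?_
  have := hcov w ((h.notMem_iff w).1 hw)
  simp [this]

lemma not_adj_cc [Finite V] (h : EPType H K a₁ a₂ a₃ b₁ b₂ b₃ c₁ c₂ c₃) (hK : CliqueLike H K)
    (hH : ¬ HamList H) : ¬ H.Adj c₁ c₂ := fun hc =>
  hH <| h.hamList hK [c₃, b₃, b₂, b₁, c₁, c₂] h.mem₃ h.mem₂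
    (nodup_of_count_le h.nodup fun _ c => by simp [List.count_cons]; omega)
    (by simp [h.adj_ac₃, h.adj_bc₃.symm, h.adj_b₂₃.symm, h.adj_b₁₂.symm, h.adj_bc₁, hc,
      h.adj_ac₂.symm]) (by simp)

lemma not_adj_cb [Finite V] (h : EPType H K a₁ a₂ a₃ b₁ b₂ b₃ c₁ c₂ c₃) (hK : CliqueLike H K)
    (hH : ¬ HamList H) : ¬ H.Adj c₁ b₂ := fun hc =>
  hH <| h.hamList hK [c₃, b₃, b₁, c₁, b₂, c₂] h.mem₃ h.mem₂
    (nodup_of_count_le h.nodup fun _ c => by simp [List.count_cons]; omega)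
    (by simp [h.adj_ac₃, h.adj_bc₃.symm, h.adj_b₁₃.symm, h.adj_bc₁, hc, h.adj_bc₂,
      h.adj_ac₂.symm]) (by simp)

lemma not_adj_c_of_mem [Finite V] (h : EPType H K a₁ a₂ a₃ b₁ b₂ b₃ c₁ c₂ c₃) (hK : CliqueLike H K)
    (hH : ¬ HamList H) {k : V} (hk : k ∈ K) (hka : k ∉ [a₁, a₂, a₃]) : ¬ H.Adj c₁ k := fun hc =>
  hH <| h.hamList hK [c₁, a₁, a₂, c₂, b₂, b₁, b₃, c₃] hk h.mem₃
    (by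
      have := h.nodup
      have := fun v => h.ne_of_mem (v := v) hk
      simp only [List.cons_append, List.nil_append]
      refine List.nodup_cons.2 ⟨by simp_all, ?_⟩
      exact nodup_of_count_le h.nodup fun _ c => by simp [List.count_cons]; omega)
    (by
      have h12 : H.Adj a₁ a₂ := hK.clique _ h.mem₁ _ h.mem₂
        (by have := h.nodup; simp at this; tauto)
      simp [hc.symm, h.adj_ac₁.symm, h12, h.adj_ac₂, h.adj_bc₂.symm, h.adj_b₁₂.symm, h.adj_b₁₃,
        h.adj_bc₃, h.adj_ac₃.symm]) (by simp)

lemma not_adj_b_of_mem [Finite V] (h : EPType H K a₁ a₂ a₃ b₁ b₂ b₃ c₁ c₂ c₃) (hK : CliqueLike H K)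
    (hH : ¬ HamList H) {k : V} (hk : k ∈ K) (hka : k ∉ [a₁, a₂, a₃]) : ¬ H.Adj b₁ k := fun hc =>
  hH <| h.hamList hK [b₁, c₁, a₁, a₂, c₂, b₂, b₃, c₃] hk h.mem₃
    (by
      have := h.nodup
      have := fun v => h.ne_of_mem (v := v) hk
      simp only [List.cons_append, List.nil_append]
      refine List.nodup_cons.2 ⟨by simp_all, ?_⟩
      exact nodup_of_count_le h.nodup fun _ c => by simp [List.count_cons]; omega)
    (by
      have h12 : H.Adj a₁ a₂ := hK.clique _ h.mem₁ _ h.mem₂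
        (by have := h.nodup; simp at this; tauto)
      simp [hc.symm, h.adj_bc₁, h.adj_ac₁.symm, h12, h.adj_ac₂, h.adj_bc₂.symm, h.adj_b₂₃,
        h.adj_bc₃, h.adj_ac₃.symm]) (by simp)

lemma not_adj_ca [Finite V] (h : EPType H K a₁ a₂ a₃ b₁ b₂ b₃ c₁ c₂ c₃) (hK : CliqueLike H K)
    (hH : ¬ HamList H) : ¬ H.Adj c₁ a₂ := fun hc =>
  h.not_adj_cc hK hH <| hK.clean _ h.mem₂ _ ((h.notMem_iff _).2 (by simp)) _
    ((h.notMem_iff _).2 (by simp)) hc.symm h.adj_ac₂ (by have := h.nodup; simp at this; tauto)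

lemma not_adj_ba [Finite V] (h : EPType H K a₁ a₂ a₃ b₁ b₂ b₃ c₁ c₂ c₃) (hK : CliqueLike H K)
    (hH : ¬ HamList H) : ¬ H.Adj b₁ a₂ := fun hc =>
  h.swap₁₂.not_adj_cb hK hH <| (hK.clean _ h.mem₂ _ ((h.notMem_iff _).2 (by simp)) _
    ((h.notMem_iff _).2 (by simp)) h.adj_ac₂ hc.symm (by have := h.nodup; simp at this; tauto))

lemma eq_of_adj_c [Finite V] (h : EPType H K a₁ a₂ a₃ b₁ b₂ b₃ c₁ c₂ c₃) (hK : CliqueLike H K)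
    (hH : ¬ HamList H) {v : V} (hv : H.Adj c₁ v) : v ∈ [a₁, b₁] := by
  have h' := h.swap₂₃
  by_cases hvK : v ∈ K
  · by_cases ha : v ∈ [a₁, a₂, a₃]
    · simp at ha
      rcases ha with rfl | rfl | rfl
      · simp
      · exact absurd hv (h.not_adj_ca hK hH)
      · exact absurd hv (h'.not_adj_ca hK hH)
    · exact absurd hv (h.not_adj_c_of_mem hK hH hvK ha)
  · have := (h.notMem_iff v).1 hvK
    simp at this
    rcases this with rfl | rfl | rfl | rfl | rfl | rfl
    · simp
    · exact absurd hv (h.not_adj_cb hK hH)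
    · exact absurd hv (h'.not_adj_cb hK hH)
    · exact absurd rfl hv.ne
    · exact absurd hv (h.not_adj_cc hK hH)
    · exact absurd hv (h'.not_adj_cc hK hH)

lemma eq_of_adj_b [Finite V] (h : EPType H K a₁ a₂ a₃ b₁ b₂ b₃ c₁ c₂ c₃) (hK : CliqueLike H K)
    (hH : ¬ HamList H) {v : V} (hv : H.Adj b₁ v) : v ∈ [a₁, c₁, b₂, b₃] := by
  have h' := h.swap₂₃
  by_cases hvK : v ∈ K
  · by_cases ha : v ∈ [a₁, a₂, a₃]
    · simp at ha
      rcases ha with rfl | rfl | rfl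
      · simp
      · exact absurd hv (h.not_adj_ba hK hH)
      · exact absurd hv (h'.not_adj_ba hK hH)
    · exact absurd hv (h.not_adj_b_of_mem hK hH hvK ha)
  · have := (h.notMem_iff v).1 hvK
    simp at this
    rcases this with rfl | rfl | rfl | rfl | rfl | rfl
    · exact absurd rfl hv.ne
    · simp
    · simp
    · simp
    · exact absurd hv.symm (h.swap₁₂.not_adj_cb hK hH)
    · exact absurd hv.symm (h'.swap₁₂.not_adj_cb hK hH)

end EPType

namespace EP'Type

variable {a₁ a₂ a₃ b₁ b₂ b₃ c₂ c₃ : V}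

lemma swap₂₃ (h : EP'Type H K a₁ a₂ a₃ b₁ b₂ b₃ c₂ c₃) :
    EP'Type H K a₁ a₃ a₂ b₁ b₃ b₂ c₃ c₂ where
  nodup := nodup_of_count_le h.nodup fun _ c => by simp [List.count_cons]; omega
  mem_a := h.mem_a
  mem_b := h.mem_b
  notMem_iff v := by
    rw [h.notMem_iff]
    simp
    tauto
  adj_a₁₂ := h.adj_a₁₃
  adj_a₁₃ := h.adj_a₁₂
  adj_a₂₃ := h.adj_a₂₃.symm
  adj_b₁₂ := h.adj_b₁₃
  adj_b₁₃ := h.adj_b₁₂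
  adj_b₂₃ := h.adj_b₂₃.symm
  adj_ac₂ := h.adj_ac₃
  adj_ac₃ := h.adj_ac₂
  adj_bc₂ := h.adj_bc₃
  adj_bc₃ := h.adj_bc₂

lemma swap (h : EP'Type H K a₁ a₂ a₃ b₁ b₂ b₃ c₂ c₃) :
    EP'Type H K b₁ b₂ b₃ a₁ a₂ a₃ c₂ c₃ where
  nodup := nodup_of_count_le h.nodup fun _ c => by simp [List.count_cons]; omega
  mem_a := h.mem_b
  mem_b := h.mem_a
  notMem_iff v := by
    rw [h.notMem_iff]
    simp
    tauto
  adj_a₁₂ := h.adj_b₁₂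
  adj_a₁₃ := h.adj_b₁₃
  adj_a₂₃ := h.adj_b₂₃
  adj_b₁₂ := h.adj_a₁₂
  adj_b₁₃ := h.adj_a₁₃
  adj_b₂₃ := h.adj_a₂₃
  adj_ac₂ := h.adj_bc₂
  adj_ac₃ := h.adj_bc₃
  adj_bc₂ := h.adj_ac₂
  adj_bc₃ := h.adj_ac₃

lemma ne_of_mem (h : EP'Type H K a₁ a₂ a₃ b₁ b₂ b₃ c₂ c₃) {k v : V} (hk : k ∈ K)
    (hv : v ∈ [a₂, a₃, b₂, b₃, c₂, c₃]) : k ≠ v := fun e => (h.notMem_iff v).2 hv (e ▸ hk)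

/-- A path between two vertices of `K` through the six vertices outside `K`. -/
lemma hamList [Finite V] (h : EP'Type H K a₁ a₂ a₃ b₁ b₂ b₃ c₂ c₃) (hK : CliqueLike H K) {u v : V}
    (t : List V) (hu : u ∈ K) (hv : v ∈ K) (hnd : (u :: t ++ [v]).Nodup)
    (hch : (u :: t ++ [v]).IsChain H.Adj) (hcov : ∀ w ∈ [a₂, a₃, b₂, b₃, c₂, c₃], w ∈ t) :
    HamList H := by
  refine hamList_of_isChain hK.clique t hu hv hnd hch fun w hw => ?_
  have := hcov w ((h.notMem_iff w).1 hw)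
  simp [this]

lemma not_adj_cc [Finite V] (h : EP'Type H K a₁ a₂ a₃ b₁ b₂ b₃ c₂ c₃) (hK : CliqueLike H K)
    (hH : ¬ HamList H) : ¬ H.Adj c₂ c₃ := fun hc =>
  hH <| h.hamList hK [a₂, a₃, c₃, c₂, b₂, b₃] h.mem_a h.mem_b
    (nodup_of_count_le h.nodup fun _ c => by simp [List.count_cons]; omega)
    (by simp [h.adj_a₁₂, h.adj_a₂₃, h.adj_ac₃, hc.symm, h.adj_bc₂.symm, h.adj_b₂₃,
      h.adj_b₁₃.symm]) (by simp)

lemma not_adj_ca [Finite V] (h : EP'Type H K a₁ a₂ a₃ b₁ b₂ b₃ c₂ c₃) (hK : CliqueLike H K)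
    (hH : ¬ HamList H) : ¬ H.Adj c₂ a₃ := fun hc =>
  hH <| h.hamList hK [a₂, c₂, a₃, c₃, b₃, b₂] h.mem_a h.mem_b
    (nodup_of_count_le h.nodup fun _ c => by simp [List.count_cons]; omega)
    (by simp [h.adj_a₁₂, h.adj_ac₂, hc, h.adj_ac₃, h.adj_bc₃.symm, h.adj_b₂₃.symm,
      h.adj_b₁₂.symm]) (by simp)

lemma not_adj_ab [Finite V] (h : EP'Type H K a₁ a₂ a₃ b₁ b₂ b₃ c₂ c₃) (hK : CliqueLike H K)
    (hH : ¬ HamList H) : ¬ H.Adj a₂ b₃ := fun hc =>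
  hH <| h.hamList hK [a₃, c₃, b₃, a₂, c₂, b₂] h.mem_a h.mem_b
    (nodup_of_count_le h.nodup fun _ c => by simp [List.count_cons]; omega)
    (by simp [h.adj_a₁₃, h.adj_ac₃, h.adj_bc₃.symm, hc.symm, h.adj_ac₂, h.adj_bc₂.symm,
      h.adj_b₁₂.symm]) (by simp)

lemma not_adj_a_of_mem [Finite V] (h : EP'Type H K a₁ a₂ a₃ b₁ b₂ b₃ c₂ c₃) (hK : CliqueLike H K)
    (hH : ¬ HamList H) {k : V} (hk : k ∈ K) (hka : k ∉ [a₁, b₁]) : ¬ H.Adj a₂ k := fun hc =>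
  hH <| h.hamList hK [a₂, c₂, b₂, b₁, b₃, c₃, a₃] hk h.mem_a
    (by
      have := h.nodup
      have := fun v => h.ne_of_mem (v := v) hk
      simp only [List.cons_append, List.nil_append]
      refine List.nodup_cons.2 ⟨by simp_all, ?_⟩
      exact nodup_of_count_le h.nodup fun _ c => by simp [List.count_cons]; omega)
    (by simp [hc.symm, h.adj_ac₂, h.adj_bc₂.symm, h.adj_b₁₂.symm, h.adj_b₁₃, h.adj_bc₃,
      h.adj_ac₃.symm, h.adj_a₁₃.symm]) (by simp)

lemma not_adj_c_of_mem [Finite V] (h : EP'Type H K a₁ a₂ a₃ b₁ b₂ b₃ c₂ c₃) (hK : CliqueLike H K)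
    (hH : ¬ HamList H) {k : V} (hk : k ∈ K) (hka : k ∉ [a₁, b₁]) : ¬ H.Adj c₂ k := fun hc =>
  hH <| h.hamList hK [c₂, b₂, b₁, b₃, c₃, a₃, a₂] hk h.mem_a
    (by
      have := h.nodup
      have := fun v => h.ne_of_mem (v := v) hk
      simp only [List.cons_append, List.nil_append]
      refine List.nodup_cons.2 ⟨by simp_all, ?_⟩
      exact nodup_of_count_le h.nodup fun _ c => by simp [List.count_cons]; omega)
    (by simp [hc.symm, h.adj_bc₂.symm, h.adj_b₁₂.symm, h.adj_b₁₃, h.adj_bc₃,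
      h.adj_ac₃.symm, h.adj_a₂₃.symm, h.adj_a₁₂.symm]) (by simp)

lemma eq_of_adj_c [Finite V] (h : EP'Type H K a₁ a₂ a₃ b₁ b₂ b₃ c₂ c₃) (hK : CliqueLike H K)
    (hH : ¬ HamList H) {v : V} (hv : H.Adj c₂ v) : v ∈ [a₂, b₂] := by
  have hnd := h.nodup
  have hclean : ∀ {a₁ a₂ a₃ b₁ b₂ b₃}, EP'Type H K a₁ a₂ a₃ b₁ b₂ b₃ c₂ c₃ → ¬ H.Adj c₂ a₁ :=
    fun h hv => h.not_adj_ca hK hH <| hK.clean _ h.mem_a _ ((h.notMem_iff _).2 (by simp)) _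
      ((h.notMem_iff _).2 (by simp)) hv.symm h.adj_a₁₃ (by have := h.nodup; simp at this; tauto)
  by_cases hvK : v ∈ K
  · by_cases ha : v ∈ [a₁, b₁]
    · simp at ha
      rcases ha with rfl | rfl
      · exact absurd hv (hclean h)
      · exact absurd hv (hclean h.swap)
    · exact absurd hv (h.not_adj_c_of_mem hK hH hvK ha)
  · have := (h.notMem_iff v).1 hvK
    simp at this
    rcases this with rfl | rfl | rfl | rfl | rfl | rfl
    · simp
    · exact absurd hv (h.not_adj_ca hK hH)
    · simp
    · exact absurd hv (h.swap.not_adj_ca hK hH)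
    · exact absurd rfl hv.ne
    · exact absurd hv (h.not_adj_cc hK hH)

lemma eq_of_adj_a [Finite V] (h : EP'Type H K a₁ a₂ a₃ b₁ b₂ b₃ c₂ c₃) (hK : CliqueLike H K)
    (hH : ¬ HamList H) {v : V} (hv : H.Adj a₂ v) : v ∈ [a₁, a₃, b₂, c₂] := by
  by_cases hvK : v ∈ K
  · by_cases ha : v ∈ [a₁, b₁]
    · simp at ha
      rcases ha with rfl | rfl
      · simp
      · refine absurd (hK.clean _ h.mem_b _ ((h.notMem_iff _).2 ?_) _ ((h.notMem_iff _).2 ?_)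
          hv.symm h.adj_b₁₃ ?_) (h.not_adj_ab hK hH)
        · simp
        · simp
        · have := h.nodup
          simp at this
          tauto
    · exact absurd hv (h.not_adj_a_of_mem hK hH hvK ha)
  · have := (h.notMem_iff v).1 hvK
    simp at this
    rcases this with rfl | rfl | rfl | rfl | rfl | rfl
    · exact absurd rfl hv.ne
    · simp
    · simp
    · exact absurd hv (h.not_adj_ab hK hH)
    · simp
    · exact absurd hv.symm (h.swap₂₃.not_adj_ca hK hH)

end EP'Type

end Exclusion

section Closure

variable {V : Type*} {H : SimpleGraph V} {K : Set V}

/-- A 2-connected graph which is a clique `K` with at most six further vertices attached without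
claws is Hamiltonian, or has the shape of `EP` or `EP'`. -/
lemma CliqueLike.exists_type [Finite V] (hK : CliqueLike H K)
    (hconn : ∀ v, (H.induce ({v}ᶜ : Set V)).Connected) (hK2 : ∃ u ∈ K, ∃ v ∈ K, u ≠ v)
    (hH : ¬ HamList H) :
    (∃ a₁ a₂ a₃ b₁ b₂ b₃ c₁ c₂ c₃, EPType H K a₁ a₂ a₃ b₁ b₂ b₃ c₁ c₂ c₃) ∨
      ∃ a₁ a₂ a₃ b₁ b₂ b₃ c₂ c₃, EP'Type H K a₁ a₂ a₃ b₁ b₂ b₃ c₂ c₃ := by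
  obtain ⟨x, A, y, B, P, h⟩ := exists_detour hconn hK.clique hK2 hH
  by_cases hA : ∃ k ∈ A, k ∈ K
  · by_cases hB : ∃ k ∈ B, k ∈ K
    · exact .inl (h.exists_epType hK hA hB)
    · push Not at hB
      exact .inr (h.swap.exists_ep'Type hK hB hK2)
  · push Not at hA
    exact .inr (h.exists_ep'Type hK hA hK2)

lemma countP_dropLast_add_countP_le {p q : V → Bool} {x : V} {t : List V}
    (h : (x :: t).IsChain fun a b => ¬ (p a ∧ q b)) :
    (x :: t).dropLast.countP p + t.countP q ≤ t.length := by
  induction t generalizing x with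
  | nil => simp
  | cons y t ih =>
    have h1 := ih h.of_cons
    have h2 := h.rel
    rw [List.dropLast_cons_cons, List.countP_cons, List.countP_cons, List.length_cons]
    grind

lemma exists_of_not_isChain {R : V → V → Prop} {l : List V} (h : ¬ l.IsChain R) :
    ∃ L a b T, l = L ++ a :: b :: T ∧ ¬ R a b := by
  induction l with
  | nil => simp at h
  | cons x l ih =>
    cases l with
    | nil => simp at h
    | cons y l =>
      by_cases hxy : R x y
      · obtain ⟨L, a, b, T, hl, hab⟩ := ih fun h' => h (h'.cons_cons hxy)
        exact ⟨x :: L, a, b, T, by simp [hl], hab⟩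
      · exact ⟨[], x, y, l, rfl, hxy⟩

lemma countP_adj [Fintype V] [DecidableRel H.Adj] {l : List V} (hnd : l.Nodup) (hl : ∀ v, v ∈ l)
    (u : V) : l.countP (fun v => H.Adj u v) = H.degree u := by
  classical
  rw [List.countP_eq_length_filter, ← List.toFinset_card_of_nodup (hnd.filter _),
    ← card_neighborFinset_eq_degree]
  congr 1
  ext v
  simp [hl v]

lemma hamList_of_hamPath [Fintype V] [DecidableRel H.Adj] {u v : V} {t : List V}
    (hnd : (u :: t ++ [v]).Nodup) (hl : ∀ w, w ∈ u :: t ++ [v])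
    (hch : (u :: t ++ [v]).IsChain H.Adj) (hdeg : Fintype.card V ≤ H.degree u + H.degree v) :
    HamList H := by
  have hlen : Fintype.card V = t.length + 2 := by
    classical
    have := List.toFinset_card_of_nodup hnd
    rw [show (u :: t ++ [v]).toFinset = Finset.univ by
      ext w
      have := hl w
      simp at this ⊢
      tauto] at this
    simpa using this
  have hn : ¬ (u :: (t ++ [v])).IsChain fun a b => ¬ (decide (H.Adj v a) ∧ decide (H.Adj u b)) := by
    intro h
    have := countP_dropLast_add_countP_le (p := fun a => H.Adj v a) (q := fun a => H.Adj u a) h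
    have h1 := countP_adj (H := H) hnd hl u
    have h2 := countP_adj (H := H) hnd hl v
    rw [← List.cons_append, List.dropLast_concat] at this
    rw [List.countP_append] at h2
    rw [List.cons_append, List.countP_cons] at h1
    simp at h1 h2 this
    omega
  obtain ⟨L, a, b, T, hT, hab⟩ := exists_of_not_isChain hn
  simp only [decide_eq_true_eq, not_not] at hab
  rw [List.cons_append] at hch hnd hl
  rw [hT] at hch hnd hl
  rw [show L ++ a :: b :: T = (L ++ [a]) ++ b :: T by simp] at hch
  have hc1 := hch.left_of_append
  have hc2 := isChain_reverse_adj.2 hch.right_of_append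
  obtain ⟨s, hs⟩ : ∃ s, L ++ [a] = u :: s := by
    cases L with
    | nil =>
      simp at hT
      exact ⟨[], by simp [hT.1]⟩
    | cons x L =>
      simp at hT
      exact ⟨L ++ [a], by simp [hT.1]⟩
  obtain ⟨r, hr⟩ : ∃ r, b :: T = r ++ [v] := by
    rcases List.eq_nil_or_concat T with rfl | ⟨T', w, rfl⟩
    · have : u :: t ++ [v] = (L ++ [a]) ++ [b] := by simpa using hT
      exact ⟨[], by simpa using (List.append_inj' this rfl).2.symm⟩
    · have : u :: t ++ [v] = (L ++ a :: b :: T') ++ [w] := by simpa using hT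
      exact ⟨b :: T', by simpa using (List.append_inj' this rfl).2.symm⟩
  refine ⟨(L ++ [a]) ++ (b :: T).reverse, ⟨nodup_of_count_le hnd fun _ c => by
    simp [List.count_cons], ?_⟩, fun w => ?_⟩
  · rw [hs, List.cons_append, List.head?_cons, Option.toList_some]
    have e : u :: (s ++ (b :: T).reverse) ++ [u] = L ++ a :: ((b :: T).reverse ++ [u]) := by
      rw [← List.cons_append, ← hs]
      simp
    rw [e, List.isChain_split]
    refine ⟨hc1, ?_⟩
    have hend : ((b :: T).reverse ++ [u]).IsChain H.Adj := by
      rw [List.reverse_cons] at hc2 ⊢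
      rw [List.append_assoc, List.singleton_append, List.isChain_split]
      exact ⟨hc2, by simpa using hab.2.symm⟩
    rw [hr, List.reverse_append, List.reverse_singleton, List.singleton_append] at hend ⊢
    exact hend.cons_cons hab.1.symm
  · have := hl w
    simp at this ⊢
    tauto

lemma isChain_of_isChain_sup_edge {u v : V} {A : List V} (hnd : (u :: A ++ [v]).Nodup)
    (hA : A ≠ []) (h : (u :: A ++ [v]).IsChain (H ⊔ edge u v).Adj) :
    (u :: A ++ [v]).IsChain H.Adj := by
  obtain ⟨a, A, rfl⟩ := List.exists_cons_of_ne_nil hA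
  have hu : u ∉ a :: A ++ [v] := (List.nodup_cons.1 hnd).1
  have hav : a ≠ v := by
    rintro rfl
    simp at hnd
  have h1 := h.rel
  refine List.IsChain.cons_cons ?_ (List.IsChain.imp_of_mem_imp ?_ h.of_cons)
  · rw [sup_adj, edge_adj] at h1
    grind
  · intro x y hx hy hxy
    rw [sup_adj, edge_adj] at hxy
    refine hxy.resolve_right ?_
    rintro ⟨⟨rfl, -⟩ | ⟨-, rfl⟩, -⟩
    · exact hu hx
    · exact hu hy

/-- The Bondy–Chvátal lemma. -/
lemma hamList_of_sup_edge [Fintype V] [DecidableRel H.Adj] {u v : V} (huv : u ≠ v)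
    (h : HamList (H ⊔ edge u v)) (hdeg : Fintype.card V ≤ H.degree u + H.degree v) :
    HamList H := by
  obtain ⟨l, hl, hmem⟩ := h
  obtain ⟨A, B, hAB, hperm⟩ := hl.exists_rotate (hmem u) (hmem v) huv
  have hmem' : ∀ w, w ∈ u :: A ++ v :: B := fun w => hperm.mem_iff.2 (hmem w)
  rw [List.cons_append, cycList_cons, show u :: (A ++ v :: B) ++ [u] = u :: A ++ v :: (B ++ [u])
    by simp, List.isChain_split] at hAB
  obtain ⟨hnd, hA, hB⟩ := hAB
  have hndA : (u :: A ++ [v]).Nodup :=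
    nodup_of_count_le hnd fun _ c => by simp [List.count_cons]
  have hndB : (v :: B ++ [u]).Nodup :=
    nodup_of_count_le hnd fun _ c => by simp [List.count_cons]; omega
  have hA' : A ≠ [] → (u :: A ++ [v]).IsChain H.Adj := fun hne =>
    isChain_of_isChain_sup_edge hndA hne hA
  have hB' : B ≠ [] → (v :: B ++ [u]).IsChain H.Adj := fun hne =>
    isChain_of_isChain_sup_edge hndB hne (by rwa [edge_comm])
  by_cases hAe : A = []
  · by_cases hadj : (v :: B ++ [u]).IsChain H.Adj
    · subst hAe
      exact hamList_of_hamPath hndB (fun w => by have := hmem' w; simp at this ⊢; tauto) hadj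
        (by omega)
    · obtain rfl : B = [] := by
        by_contra hne
        exact hadj (hB' hne)
      subst hAe
      have h2 : ∀ w, w = u ∨ w = v := by simpa using hmem'
      have hvu : ¬ H.Adj v u := by simpa using hadj
      have hzero : ∀ w, H.degree w = 0 := by
        intro w
        rw [← card_neighborFinset_eq_degree, Finset.card_eq_zero]
        ext z
        have := H.adj_comm u v
        rcases h2 w with rfl | rfl <;> rcases h2 z with rfl | rfl <;> simp_all
      have : 0 < Fintype.card V := Fintype.card_pos_iff.2 ⟨u⟩
      simp only [hzero] at hdeg
      omega
  · by_cases hBe : B = []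
    · subst hBe
      exact hamList_of_hamPath hndA hmem' (hA' hAe) hdeg
    · refine ⟨u :: (A ++ v :: B), cycList_cons.2 ⟨hnd, ?_⟩, hmem'⟩
      rw [show u :: (A ++ v :: B) ++ [u] = u :: A ++ v :: (B ++ [u]) by simp, List.isChain_split]
      exact ⟨hA' hAe, hB' hBe⟩

/-- The Bondy–Chvátal closure. -/
lemma exists_closure [Fintype V] (G : SimpleGraph V) :
    ∃ (H : SimpleGraph V) (_ : DecidableRel H.Adj), G ≤ H ∧ (HamList H → HamList G) ∧
      ∀ u v, u ≠ v → ¬ H.Adj u v → H.degree u + H.degree v < Fintype.card V := by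
  classical
  obtain ⟨H, hGH, hH⟩ :=
    (Set.toFinite {H : SimpleGraph V | HamList H → HamList G}).exists_le_maximal
    (a := G) (fun h => h)
  refine ⟨H, Classical.decRel _, hGH, hH.1, fun u v huv hadj => ?_⟩
  by_contra! hdeg
  have hle : H ⊔ edge u v ≤ H :=
    hH.2 (fun h => hH.1 (hamList_of_sup_edge huv h hdeg)) le_sup_left
  exact hadj (hle (by simp [edge_adj, huv]))

/-- The graph obtained by making `K` a clique. -/
def addClique (G : SimpleGraph V) (K : Set V) : SimpleGraph V where
  Adj u v := G.Adj u v ∨ u ∈ K ∧ v ∈ K ∧ u ≠ v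
  symm := ⟨fun u v h => by
    rcases h with h | h
    · exact .inl h.symm
    · exact .inr ⟨h.2.1, h.1, h.2.2.symm⟩⟩
  loopless := ⟨fun u h => by simp at h⟩

lemma hamList_of_addClique [Fintype V] {G : SimpleGraph V} [DecidableRel G.Adj]
    (hpre : ∀ s ∉ K, ∀ k ∈ K, G.degree s ≤ G.degree k)
    (hcount : ∀ h, 2 * h < Fintype.card V → (∃ k ∈ K, G.degree k ≤ h) →
      (Finset.univ.filter fun v => G.degree v ≤ h).card < h)
    (hH : HamList (addClique G K)) : HamList G := by
  classical
  obtain ⟨H, _, hGH, hHG, hH'⟩ := exists_closure G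
  refine hHG (hH.mono fun u v huv => ?_)
  rcases huv with huv | ⟨hu, hv, huv⟩
  · exact hGH huv
  by_contra hadj
  obtain ⟨⟨x, y⟩, hxy, hmax⟩ := Finset.exists_max_image
    (Finset.univ.filter fun p : V × V => p.1 ∈ K ∧ p.2 ∈ K ∧ p.1 ≠ p.2 ∧ ¬ H.Adj p.1 p.2)
    (fun p => H.degree p.1 + H.degree p.2) ⟨(u, v), by simp [hu, hv, huv, hadj]⟩
  simp only [Finset.mem_filter, Finset.mem_univ, true_and] at hxy hmax
  wlog hle : H.degree x ≤ H.degree y generalizing x y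
  · exact this y x ⟨hxy.2.1, hxy.1, hxy.2.2.1.symm, fun h => hxy.2.2.2 h.symm⟩
      (fun p hp => (hmax p hp).trans (Nat.add_comm _ _).le) (by omega)
  have hsum := hH' x y hxy.2.2.1 hxy.2.2.2
  have hdx : G.degree x ≤ H.degree x := degree_le_of_le hGH
  refine (hcount (H.degree x) (by omega) ⟨x, hxy.1, hdx⟩).not_ge ?_
  have hsub : Hᶜ.neighborFinset y ⊆ Finset.univ.filter fun v => G.degree v ≤ H.degree x := by
    intro w hw
    rw [mem_neighborFinset, compl_adj] at hw
    simp only [Finset.mem_filter, Finset.mem_univ, true_and]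
    by_cases hwK : w ∈ K
    · have := hmax (w, y) ⟨hwK, hxy.2.1, hw.1.symm, fun h => hw.2 h.symm⟩
      have hdw : G.degree w ≤ H.degree w := degree_le_of_le hGH
      simp at this
      omega
    · exact (hpre w hwK x hxy.1).trans hdx
  have := Finset.card_le_card hsub
  rw [card_neighborFinset_eq_degree, degree_compl] at this
  omega

end Closure

section Degrees

open Finset

/-- A monotone sequence `D` with few small terms, as given by the sum of squares of `n - 1 - D i`,
has a gap among the first seven terms. -/
lemma exists_gap {n : ℕ} {D : ℕ → ℕ} (hn : 219 ≤ n)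
    (hmono : ∀ i j, i ≤ j → j < n → D i ≤ D j) (h2 : 2 ≤ D 0)
    (hsq : (1000 : ℤ) * ∑ i ∈ range n, ((n : ℤ) - 1 - D i) ^ 2 ≤
      6408 * (n : ℤ) ^ 2 - 36000 * (n : ℤ)) :
    ∃ i ≤ 6, (∀ j, i ≤ j → 2 * (j + 1) < n → j + 2 ≤ D j) ∧
      (2 ≤ i → D (i - 1) + D (i - 2) + 1 ≤ D i) := by
  have hn' : (219 : ℤ) ≤ n := by exact_mod_cast hn
  have hle : ∀ m ≤ n, ∑ i ∈ range m, ((n : ℤ) - 1 - D i) ^ 2 ≤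
      ∑ i ∈ range n, ((n : ℤ) - 1 - D i) ^ 2 := fun m hm =>
    sum_le_sum_of_subset_of_nonneg (range_mono hm) fun _ _ _ => sq_nonneg _
  have key : ∀ m t : ℕ, 1 ≤ m → m ≤ n → t + 1 ≤ n → D (m - 1) ≤ t →
      1000 * (m * ((n : ℤ) - 1 - t) ^ 2) ≤ 6408 * n ^ 2 - 36000 * n := by
    intro m t h1 hm ht hD
    refine le_trans (mul_le_mul_of_nonneg_left ((?_ : _ ≤ _).trans (hle m hm)) (by simp)) hsq
    have := card_nsmul_le_sum (range m) (fun i => ((n : ℤ) - 1 - D i) ^ 2)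
      (((n : ℤ) - 1 - t) ^ 2) fun i hi => by
        have h3 := hmono i (m - 1) (by have := mem_range.1 hi; omega) (by omega)
        exact pow_le_pow_left₀ (by omega) (by omega) 2
    simpa using this
  have hbig : ∀ j, 7 ≤ j → 2 * (j + 1) < n → j + 2 ≤ D j := by
    intro j hj hjn
    by_contra! hD
    rcases le_or_gt j 14 with h14 | h14
    · have := key 8 15 (by simp) (by omega) (by omega)
        ((hmono 7 j (by omega) (by omega)).trans (by omega))
      push_cast at this
      nlinarith
    rcases le_or_gt j 24 with h24 | h24
    · have := key 16 25 (by simp) (by omega) (by omega)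
        ((hmono 15 j (by omega) (by omega)).trans (by omega))
      push_cast at this
      nlinarith
    · have := key 26 (j + 1) (by simp) (by omega) (by omega)
        ((hmono 25 j (by omega) (by omega)).trans (by omega))
      push_cast at this
      have h4 : (2 * ((j : ℤ) + 1)) ≤ n - 1 := by omega
      have h5 : ((n : ℤ) - 1) ^ 2 ≤ (2 * ((n : ℤ) - 1 - (j + 1))) ^ 2 :=
        pow_le_pow_left₀ (by omega) (by omega) 2
      nlinarith
  have hsum : 67 ≤ ∑ i ∈ range 7, D i := by
    by_contra! hD
    have h1 := sq_sum_le_card_mul_sum_sq (s := range 7) (f := fun i => (n : ℤ) - 1 - D i)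
    have h2 := hle 7 (by omega)
    rw [sum_sub_distrib, ← Nat.cast_sum] at h1
    set s := ∑ i ∈ range 7, D i
    simp only [sum_const, card_range, nsmul_eq_mul] at h1
    push_cast at h1
    have h3 : (7 * (n : ℤ) - 73) ^ 2 ≤ (7 * ((n : ℤ) - 1) - s) ^ 2 :=
      pow_le_pow_left₀ (by omega) (by omega) 2
    nlinarith
  simp only [sum_range_succ, range_zero, sum_empty] at hsum
  have m0 := hmono 0 1 (by simp) (by omega)
  have m1 := hmono 1 2 (by simp) (by omega)
  have m2 := hmono 2 3 (by simp) (by omega)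
  have m3 := hmono 3 4 (by simp) (by omega)
  have m4 := hmono 4 5 (by simp) (by omega)
  have m5 := hmono 5 6 (by simp) (by omega)
  have red : ∀ i ≤ 6, (∀ j, i ≤ j → j ≤ 6 → j + 2 ≤ D j) →
      ∀ j, i ≤ j → 2 * (j + 1) < n → j + 2 ≤ D j := by
    intro i _ h j hij hj
    rcases le_or_gt j 6 with h6 | h6
    · exact h j hij h6
    · exact hbig j h6 hj
  by_contra! hcon
  have c : ∀ i ≤ 6, (∀ j, i ≤ j → j ≤ 6 → j + 2 ≤ D j) →
      2 ≤ i ∧ D i < D (i - 1) + D (i - 2) + 1 := fun i hi h => hcon i hi (red i hi h)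
  have e6 : 8 ≤ D 6 := by omega
  have c6 := c 6 (by simp) fun j h h' => by
    obtain rfl : j = 6 := by omega
    exact e6
  simp only [Nat.reduceLeDiff, Nat.reduceSub, true_and] at c6
  by_cases e5 : 7 ≤ D 5
  swap
  · omega
  have c5 := c 5 (by simp) fun j h h' => by interval_cases j <;> assumption
  simp only [Nat.reduceLeDiff, Nat.reduceSub, true_and] at c5
  by_cases e4 : 6 ≤ D 4
  swap
  · omega
  have c4 := c 4 (by simp) fun j h h' => by interval_cases j <;> assumption
  simp only [Nat.reduceLeDiff, Nat.reduceSub, true_and] at c4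
  by_cases e3 : 5 ≤ D 3
  swap
  · omega
  have c3 := c 3 (by simp) fun j h h' => by interval_cases j <;> assumption
  simp only [Nat.reduceLeDiff, Nat.reduceSub, true_and] at c3
  by_cases e2 : 4 ≤ D 2
  swap
  · omega
  have c2 := c 2 (by simp) fun j h h' => by interval_cases j <;> assumption
  simp only [Nat.reduceLeDiff, Nat.reduceSub, true_and] at c2
  by_cases e1 : 3 ≤ D 1
  swap
  · omega
  have c1 := c 1 (by simp) fun j h h' => by interval_cases j <;> assumption
  omega

lemma exists_small_set {V : Type*} [Fintype V] {n : ℕ} (hcard : Fintype.card V = n)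
    (hn : 219 ≤ n) {d : V → ℕ} (h2 : ∀ v, 2 ≤ d v)
    (hsq : (1000 : ℤ) * ∑ v, ((n : ℤ) - 1 - d v) ^ 2 ≤
      6408 * (n : ℤ) ^ 2 - 36000 * (n : ℤ)) :
    ∃ S : Finset V, S.card ≤ 6 ∧ (∀ s ∈ S, ∀ k ∉ S, d s ≤ d k) ∧
      (∀ h, 2 * h < n → (∃ k ∉ S, d k ≤ h) → (univ.filter fun v => d v ≤ h).card < h) ∧
      ∀ k ∉ S, ∀ s ∈ S, ∀ t ∈ S, s ≠ t → d s + d t < d k := by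
  classical
  obtain ⟨σ, hσ⟩ : ∃ σ : Fin n ≃ V, Monotone (d ∘ σ) :=
    let e := (Fintype.equivFinOfCardEq hcard).symm
    ⟨(Tuple.sort (d ∘ e)).trans e, Tuple.monotone_sort (d ∘ e)⟩
  set D : ℕ → ℕ := fun i => if h : i < n then d (σ ⟨i, h⟩) else 0 with hDdef
  have hD : ∀ i : Fin n, D i = d (σ i) := fun i => by simp [hDdef]
  have hD' : ∀ j (h : j < n), D j = d (σ ⟨j, h⟩) := fun j h => hD ⟨j, h⟩
  obtain ⟨i, hi6, hi, hgap⟩ := exists_gap (D := D) hn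
    (fun i j hij hj => by
      have := hσ (a := ⟨i, by omega⟩) (b := ⟨j, hj⟩) hij
      simpa [hDdef, hj, lt_of_le_of_lt hij hj] using this)
    (by simp [hDdef, h2, show 0 < n by omega])
    (by
      rw [← Fin.sum_univ_eq_sum_range fun i => ((n : ℤ) - 1 - D i) ^ 2]
      simp only [hD]
      rwa [Equiv.sum_comp σ fun v => ((n : ℤ) - 1 - d v) ^ 2])
  have hmem : ∀ j : Fin n, σ j ∈ (univ.filter fun j : Fin n => (j : ℕ) < i).map σ.toEmbedding ↔
      (j : ℕ) < i := by simp
  refine ⟨(univ.filter fun j : Fin n => (j : ℕ) < i).map σ.toEmbedding, ?_, ?_, ?_, ?_⟩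
  · rw [card_map]
    have := card_le_card_of_injOn (s := univ.filter fun j : Fin n => (j : ℕ) < i) (t := range i)
      (fun j => (j : ℕ)) (fun j hj => by simpa using hj) (fun a _ b _ h => Fin.ext h)
    rw [card_range] at this
    omega
  · intro s hs k hk
    obtain ⟨p, rfl⟩ := σ.surjective s
    obtain ⟨q, rfl⟩ := σ.surjective k
    rw [hmem] at hs hk
    exact hσ (show p ≤ q by rw [Fin.le_def]; omega)
  · rintro h hh ⟨k, hk, hkh⟩
    obtain ⟨q, rfl⟩ := σ.surjective k
    rw [hmem] at hk
    have h1 : D i ≤ d (σ q) := by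
      rw [hD' _ (by omega)]
      have := hσ (a := ⟨i, by omega⟩) (b := q) (by rw [Fin.le_def]; simpa using hk)
      simpa using this
    have h3 := hi i le_rfl (by omega)
    have h4 := hi (h - 1) (by omega) (by omega)
    rw [hD' _ (by omega)] at h4
    have hsub : (univ.filter fun v => d v ≤ h) ⊆
        (univ.filter fun j : Fin n => (j : ℕ) < h - 1).map σ.toEmbedding := by
      intro v hv
      obtain ⟨p, rfl⟩ := σ.surjective v
      simp only [mem_filter, mem_univ, true_and] at hv
      simp only [mem_map_equiv, Equiv.symm_apply_apply, mem_filter, mem_univ, true_and]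
      by_contra! hp
      have := hσ (a := ⟨h - 1, by omega⟩) (b := p) (by rw [Fin.le_def]; simpa using hp)
      simp at this
      omega
    have h5 := card_le_card hsub
    rw [card_map] at h5
    have := card_le_card_of_injOn (s := univ.filter fun j : Fin n => (j : ℕ) < h - 1)
      (t := range (h - 1))
      (fun j => (j : ℕ)) (fun j hj => by simpa using hj) (fun a _ b _ h => Fin.ext h)
    rw [card_range] at this
    omega
  · intro k hk s hs t ht hst
    obtain ⟨p, rfl⟩ := σ.surjective s
    obtain ⟨q, rfl⟩ := σ.surjective t
    obtain ⟨r, rfl⟩ := σ.surjective k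
    rw [hmem] at hk hs ht
    wlog hpq : p ≤ q generalizing p q
    · rw [Nat.add_comm]
      exact this q ht p hs hst.symm (le_of_not_ge hpq)
    have hpq' : p < q := lt_of_le_of_ne hpq fun e => hst (e ▸ rfl)
    rw [Fin.lt_def] at hpq'
    have g := hgap (by omega)
    rw [hD' (i - 1) (by omega), hD' (i - 2) (by omega), hD' i (by omega)] at g
    have g1 := hσ (a := p) (b := ⟨i - 2, by omega⟩) (by rw [Fin.le_def]; simp; omega)
    have g2 := hσ (a := q) (b := ⟨i - 1, by omega⟩) (by rw [Fin.le_def]; simp; omega)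
    have g3 := hσ (a := ⟨i, by omega⟩) (b := r) (by rw [Fin.le_def]; simpa using hk)
    simp only [Function.comp] at g1 g2 g3
    omega

end Degrees

section Spectral

open Finset Matrix

variable {V : Type*} [Fintype V] [DecidableEq V] (H : SimpleGraph V) [DecidableRel H.Adj]

lemma adjSpectralRadius_eq : adjSpectralRadius H =
    sSup {μ : ℝ | ∃ x : V → ℝ, x ≠ 0 ∧ H.adjMatrix ℝ *ᵥ x = μ • x} := by
  unfold adjSpectralRadius
  congr!

lemma finite_setOf_adjMatrix_eigenvalue :
    {μ : ℝ | ∃ x : V → ℝ, x ≠ 0 ∧ H.adjMatrix ℝ *ᵥ x = μ • x}.Finite := by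
  refine (Module.End.finite_hasEigenvalue (Matrix.toLin' (H.adjMatrix ℝ))).subset ?_
  rintro μ ⟨x, hx, h⟩
  exact Module.End.hasEigenvalue_of_hasEigenvector (x := x)
    ⟨Module.End.mem_eigenspace_iff.2 (by simpa using h), hx⟩

lemma exists_mulVec_eq_adjSpectralRadius_smul [Nonempty V] :
    ∃ x : V → ℝ, x ≠ 0 ∧ H.adjMatrix ℝ *ᵥ x = adjSpectralRadius H • x := by
  rw [adjSpectralRadius_eq]
  refine Set.Nonempty.csSup_mem ?_ (finite_setOf_adjMatrix_eigenvalue H)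
  have hA : (H.adjMatrix ℝ).IsHermitian := by
    rw [Matrix.IsHermitian, Matrix.conjTranspose_eq_transpose_of_trivial, transpose_adjMatrix]
  let i : V := Classical.arbitrary V
  refine ⟨hA.eigenvalues i, (hA.eigenvectorBasis i).ofLp, ?_, hA.mulVec_eigenvectorBasis i⟩
  intro h
  exact hA.eigenvectorBasis.orthonormal.ne_zero i (by ext v; exact congrFun h v)

lemma posSemidef_adjSpectralRadius_sub :
    (adjSpectralRadius H • (1 : Matrix V V ℝ) - H.adjMatrix ℝ).PosSemidef := by
  have hA : (H.adjMatrix ℝ).IsHermitian := by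
    rw [Matrix.IsHermitian, Matrix.conjTranspose_eq_transpose_of_trivial, transpose_adjMatrix]
  have hM : (adjSpectralRadius H • (1 : Matrix V V ℝ) - H.adjMatrix ℝ).IsHermitian :=
    IsHermitian.sub (by simp [IsHermitian]) hA
  rw [hM.posSemidef_iff_eigenvalues_nonneg]
  intro i
  have h := hM.mulVec_eigenvectorBasis i
  have hne : (hM.eigenvectorBasis i).ofLp ≠ 0 := fun h =>
    hM.eigenvectorBasis.orthonormal.ne_zero i (by ext v; exact congrFun h v)
  set x := (hM.eigenvectorBasis i).ofLp
  have := le_csSup (finite_setOf_adjMatrix_eigenvalue H).bddAbove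
    (show adjSpectralRadius H - hM.eigenvalues i ∈ _ from ⟨x, hne, by
      rw [sub_smul, ← h, sub_mulVec, smul_mulVec, one_mulVec, sub_sub_cancel]⟩)
  rw [← adjSpectralRadius_eq] at this
  simpa using this

lemma dotProduct_adjMatrix_mulVec_le (x : V → ℝ) :
    x ⬝ᵥ H.adjMatrix ℝ *ᵥ x ≤ adjSpectralRadius H * (x ⬝ᵥ x) := by
  have := (posSemidef_adjSpectralRadius_sub H).dotProduct_mulVec_nonneg x
  rw [sub_mulVec, smul_mulVec, one_mulVec, dotProduct_sub, dotProduct_smul] at this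
  simpa using this

omit [DecidableEq V] in
lemma dotProduct_adjMatrix_mulVec_eq_sum (x y : V → ℝ) :
    x ⬝ᵥ H.adjMatrix ℝ *ᵥ y = ∑ u, ∑ v, if H.Adj u v then x u * y v else 0 := by
  simp only [dotProduct, mulVec, mul_sum, adjMatrix_apply]
  simp

omit [DecidableEq V] in
lemma abs_dotProduct_adjMatrix_mulVec_le (x : V → ℝ) :
    |x ⬝ᵥ H.adjMatrix ℝ *ᵥ x| ≤ |x| ⬝ᵥ H.adjMatrix ℝ *ᵥ |x| := by
  rw [dotProduct_adjMatrix_mulVec_eq_sum, dotProduct_adjMatrix_mulVec_eq_sum]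
  refine (abs_sum_le_sum_abs _ _).trans (sum_le_sum fun u _ => (abs_sum_le_sum_abs _ _).trans
    (sum_le_sum fun v _ => ?_))
  split_ifs <;> simp [abs_mul]

omit [DecidableEq V] in
lemma abs_dotProduct_abs (x : V → ℝ) : |x| ⬝ᵥ |x| = x ⬝ᵥ x := by
  simp [dotProduct]

lemma exists_nonneg_mulVec_eq_adjSpectralRadius_smul [Nonempty V] :
    ∃ x : V → ℝ, 0 ≤ x ∧ x ≠ 0 ∧ H.adjMatrix ℝ *ᵥ x = adjSpectralRadius H • x := by
  obtain ⟨x, hx, h⟩ := exists_mulVec_eq_adjSpectralRadius_smul H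
  refine ⟨|x|, abs_nonneg x, by simpa using hx, ?_⟩
  have h1 := (le_abs_self _).trans (abs_dotProduct_adjMatrix_mulVec_le H x)
  rw [h, dotProduct_smul, smul_eq_mul, ← abs_dotProduct_abs] at h1
  have h2 := ((posSemidef_adjSpectralRadius_sub H).dotProduct_mulVec_zero_iff |x|).1 (by
    have := dotProduct_adjMatrix_mulVec_le H |x|
    rw [sub_mulVec, smul_mulVec, one_mulVec, dotProduct_sub, dotProduct_smul]
    simp only [star_trivial, smul_eq_mul]
    linarith)
  rw [sub_mulVec, smul_mulVec, one_mulVec] at h2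
  exact (sub_eq_zero.1 h2).symm

lemma sum_degree_sq_le {θ : ℝ} (hθ : 0 < θ) (h : adjSpectralRadius H ≤ θ) :
    ∑ v, (H.degree v : ℝ) ^ 2 ≤ Fintype.card V * θ ^ 2 := by
  have hpos : ∀ x : V → ℝ, 0 ≤ x ⬝ᵥ x := fun x => sum_nonneg fun v _ => mul_self_nonneg _
  have key : ∀ x : V → ℝ, |x ⬝ᵥ H.adjMatrix ℝ *ᵥ x| ≤ θ * (x ⬝ᵥ x) := fun x =>
    (abs_dotProduct_adjMatrix_mulVec_le H x).trans <| by
      rw [← abs_dotProduct_abs x]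
      exact (dotProduct_adjMatrix_mulVec_le H _).trans
        (mul_le_mul_of_nonneg_right h (hpos _))
  set u : V → ℝ := fun v => H.degree v with hu
  set e : V → ℝ := fun _ => θ with he
  have hAe : H.adjMatrix ℝ *ᵥ e = θ • u := by
    ext v; simp [he, hu, mul_comm]
  have hsymm : ∀ x y : V → ℝ, x ⬝ᵥ H.adjMatrix ℝ *ᵥ y = y ⬝ᵥ H.adjMatrix ℝ *ᵥ x := by
    intro x y
    rw [dotProduct_mulVec, ← mulVec_transpose, transpose_adjMatrix, dotProduct_comm]
  have h1 := (le_abs_self _).trans (key (e + u))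
  have h2 := (neg_le_abs _).trans (key (e - u))
  simp only [mulVec_add, mulVec_sub, dotProduct_add, add_dotProduct, dotProduct_sub,
    sub_dotProduct, hsymm e u, hAe, dotProduct_smul, smul_eq_mul] at h1 h2
  have h3 : e ⬝ᵥ e = Fintype.card V * θ ^ 2 := by simp [dotProduct, he, sq]
  have h4 : u ⬝ᵥ u = ∑ v, (H.degree v : ℝ) ^ 2 := by simp [dotProduct, hu, sq]
  rw [h3, h4] at h1 h2
  rw [dotProduct_comm e u] at h1 h2
  refine le_of_mul_le_mul_left ?_ hθ
  linarith

/-- A positive supersolution bounds the spectral radius from above. -/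
lemma adjSpectralRadius_le [Nonempty V] {θ : ℝ} {x : V → ℝ} (hx : ∀ v, 0 < x v)
    (h : ∀ v, ∑ w, (if H.Adj v w then x w else 0) ≤ θ * x v) : adjSpectralRadius H ≤ θ := by
  obtain ⟨z, hz0, hz, hAz⟩ := exists_nonneg_mulVec_eq_adjSpectralRadius_smul H
  have h1 : 0 < z ⬝ᵥ x := by
    obtain ⟨v, hv⟩ := Function.ne_iff.1 hz
    exact sum_pos' (fun v _ => mul_nonneg (hz0 v) (hx v).le)
      ⟨v, mem_univ v, mul_pos (lt_of_le_of_ne (hz0 v) hv.symm) (hx v)⟩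
  refine le_of_mul_le_mul_right ?_ h1
  calc adjSpectralRadius H * (z ⬝ᵥ x) = (H.adjMatrix ℝ *ᵥ z) ⬝ᵥ x := by simp [hAz]
    _ = z ⬝ᵥ H.adjMatrix ℝ *ᵥ x := by
      rw [dotProduct_mulVec, ← mulVec_transpose, transpose_adjMatrix]
    _ ≤ z ⬝ᵥ (θ • x) := by
      refine sum_le_sum fun v _ => mul_le_mul_of_nonneg_left ?_ (hz0 v)
      simpa [mulVec, dotProduct, adjMatrix_apply] using h v
    _ = θ * (z ⬝ᵥ x) := by simp

/-- A nonnegative subsolution bounds the spectral radius from below. -/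
lemma lt_adjSpectralRadius {θ : ℝ} {x : V → ℝ} (hx : ∀ v, 0 < x v)
    (h : ∀ v, θ * x v ≤ ∑ w, if H.Adj v w then x w else 0)
    (h' : ∃ v, θ * x v < ∑ w, if H.Adj v w then x w else 0) : θ < adjSpectralRadius H := by
  obtain ⟨v, hv⟩ := h'
  have h1 : 0 < x ⬝ᵥ x :=
    sum_pos (fun v _ => mul_pos (hx v) (hx v)) ⟨v, mem_univ v⟩
  refine lt_of_mul_lt_mul_right ?_ h1.le
  refine lt_of_lt_of_le ?_ (dotProduct_adjMatrix_mulVec_le H x)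
  rw [← smul_eq_mul, ← dotProduct_smul]
  refine sum_lt_sum (fun v _ => mul_le_mul_of_nonneg_left ?_ (hx v).le)
    ⟨v, mem_univ v, mul_lt_mul_of_pos_left ?_ (hx v)⟩
  · simpa [mulVec, dotProduct, adjMatrix_apply] using h v
  · simpa [mulVec, dotProduct, adjMatrix_apply] using hv

omit [DecidableEq V] in
variable {H} in
lemma pos_of_mulVec_eq_smul (hconn : H.Connected) {z : V → ℝ} {μ : ℝ} (hz0 : 0 ≤ z)
    (hz : z ≠ 0) (h : H.adjMatrix ℝ *ᵥ z = μ • z) (v : V) : 0 < z v := by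
  have step : ∀ u w, H.Adj u w → 0 < z u → 0 < z w := by
    intro u w huw hu
    refine lt_of_le_of_ne (hz0 w) fun hw => ?_
    have h1 := congrFun h w
    rw [Pi.smul_apply, ← hw, smul_zero] at h1
    rw [adjMatrix_mulVec_apply, sum_eq_zero_iff_of_nonneg fun i _ => hz0 i] at h1
    exact hu.ne' (h1 u (by simpa using huw.symm))
  obtain ⟨u, hu⟩ := Function.ne_iff.1 hz
  obtain ⟨p⟩ := hconn.preconnected u v
  induction p with
  | nil => exact lt_of_le_of_ne (hz0 _) hu.symm
  | cons huw p ih => exact ih (step _ _ huw (lt_of_le_of_ne (hz0 _) (Ne.symm hu))).ne'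

/-- The spectral radius strictly increases when edges are added to a connected graph. -/
lemma adjSpectralRadius_lt_of_equiv {W : Type*} [Fintype W] [DecidableEq W]
    {H' : SimpleGraph W} (hconn : H'.Connected) (f : V ≃ W)
    (hle : ∀ u v, H'.Adj (f u) (f v) → H.Adj u v)
    (hne : ∃ u v, H.Adj u v ∧ ¬ H'.Adj (f u) (f v)) :
    adjSpectralRadius H' < adjSpectralRadius H := by
  classical
  have := hconn.nonempty
  obtain ⟨z, hz0, hz, hAz⟩ := exists_nonneg_mulVec_eq_adjSpectralRadius_smul H'
  have hpos := pos_of_mulVec_eq_smul hconn hz0 hz hAz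
  obtain ⟨a, b, hab, hab'⟩ := hne
  have h1 : 0 < z ⬝ᵥ z :=
    sum_pos (fun v _ => mul_pos (hpos v) (hpos v)) ⟨f a, mem_univ _⟩
  have h2 : (z ∘ f) ⬝ᵥ (z ∘ f) = z ⬝ᵥ z := f.sum_comp fun v => z v * z v
  refine lt_of_mul_lt_mul_right ?_ h1.le
  rw [← h2]
  refine lt_of_lt_of_le ?_ (dotProduct_adjMatrix_mulVec_le H _)
  rw [h2, ← smul_eq_mul, ← dotProduct_smul, ← hAz, dotProduct_adjMatrix_mulVec_eq_sum,
    dotProduct_adjMatrix_mulVec_eq_sum, ← f.sum_comp]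
  simp only [← f.sum_comp (fun w => ite _ _ _)]
  have hterm : ∀ u v, (if H'.Adj (f u) (f v) then z (f u) * z (f v) else 0) ≤
      if H.Adj u v then (z ∘ f) u * (z ∘ f) v else 0 := by
    intro u v
    have := mul_pos (hpos (f u)) (hpos (f v))
    split_ifs with h h' h'
    · exact le_rfl
    · exact absurd (hle u v h) h'
    · exact this.le
    · exact le_rfl
  refine sum_lt_sum (fun u _ => sum_le_sum fun v _ => hterm u v)
    ⟨a, mem_univ a, sum_lt_sum (fun v _ => hterm a v) ⟨b, mem_univ b, ?_⟩⟩
  rw [if_pos hab, if_neg hab']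
  exact mul_pos (hpos _) (hpos _)

end Spectral

section Weights

open Finset

variable {V : Type*} [Fintype V] {P : V → Prop} [DecidablePred P] {x : V → ℝ} {l : List V}

lemma sum_ite_le_sum_map (hx : ∀ v, 0 ≤ x v) (h : ∀ w, P w → w ∈ l) :
    ∑ w, (if P w then x w else 0) ≤ (l.map x).sum := by
  classical
  have h1 : ∑ w, (if P w then x w else 0) ≤ ∑ w ∈ l.toFinset, x w := by
    rw [← sum_filter]
    exact sum_le_sum_of_subset_of_nonneg (fun w hw => by simpa using h w (by simpa using hw))
      fun v _ _ => hx v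
  refine h1.trans ?_
  clear h h1
  induction l with
  | nil => simp
  | cons a l ih =>
    rw [List.toFinset_cons, List.map_cons, List.sum_cons]
    by_cases ha : a ∈ l.toFinset
    · rw [insert_eq_of_mem ha]
      linarith [hx a]
    · rw [sum_insert ha]
      linarith

lemma sum_map_le_sum_ite (hx : ∀ v, 0 ≤ x v) (hl : l.Nodup) (h : ∀ w ∈ l, P w) :
    (l.map x).sum ≤ ∑ w, (if P w then x w else 0) := by
  classical
  rw [← List.sum_toFinset _ hl, ← sum_filter]
  exact sum_le_sum_of_subset_of_nonneg (fun w hw => by simpa using h w (by simpa using hw))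
    fun v _ _ => hx v

lemma sum_ite_add_sum_ite_not :
    ∑ w, (if P w then x w else 0) + ∑ w, (if ¬ P w then x w else 0) = ∑ w, x w := by
  rw [← sum_add_distrib]
  exact sum_congr rfl fun w _ => by by_cases h : P w <;> simp [h]

lemma sum_ite_le_sum_sub (hx : ∀ v, 0 ≤ x v) (hl : l.Nodup) (h : ∀ w ∈ l, ¬ P w) :
    ∑ w, (if P w then x w else 0) ≤ ∑ w, x w - (l.map x).sum := by
  rw [← sum_ite_add_sum_ite_not (P := P) (x := x)]
  linarith [sum_map_le_sum_ite hx hl h]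

lemma sum_sub_le_sum_ite (hx : ∀ v, 0 ≤ x v) (h : ∀ w, ¬ P w → w ∈ l) :
    ∑ w, x w - (l.map x).sum ≤ ∑ w, (if P w then x w else 0) := by
  rw [← sum_ite_add_sum_ite_not (P := P) (x := x)]
  linarith [sum_ite_le_sum_map hx h]

end Weights

section Bounds

variable {V : Type*} [Fintype V] [DecidableEq V] {H : SimpleGraph V} {K : Set V}
  {a₁ a₂ a₃ b₁ b₂ b₃ c₁ c₂ c₃ : V} {n : ℕ} {θ : ℝ}

theorem EP'Type.adjSpectralRadius_compl_le (h : EP'Type H K a₁ a₂ a₃ b₁ b₂ b₃ c₂ c₃)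
    (hK : ∀ u ∈ K, ∀ v ∈ K, u ≠ v → H.Adj u v) (h₂ : H.Adj a₂ b₂) (h₃ : H.Adj a₃ b₃)
    (hcard : Fintype.card V = n) (hθ : 36 ≤ θ)
    (hθn : θ ^ 2 = 6 * (n - 6) + 12 / 5 * θ) : adjSpectralRadius Hᶜ ≤ θ := by
  classical
  set x : V → ℝ := fun v => 1 + (if v = a₁ then -3 / 10 else 0) + (if v = b₁ then -3 / 10 else 0) +
    (if v = a₂ then θ / 6 - 16 / 15 else 0) + (if v = a₃ then θ / 6 - 16 / 15 else 0) +
    (if v = b₂ then θ / 6 - 16 / 15 else 0) + (if v = b₃ then θ / 6 - 16 / 15 else 0) +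
    (if v = c₂ then θ / 6 - 13 / 15 else 0) + (if v = c₃ then θ / 6 - 13 / 15 else 0) with hx
  have hsum : ∑ v, x v = n - 3 / 5 + 4 * (θ / 6 - 16 / 15) + 2 * (θ / 6 - 13 / 15) := by
    simp only [hx, Finset.sum_add_distrib, Finset.sum_ite_eq', Finset.mem_univ, if_true]
    simp [hcard]
    ring
  have hnd := h.nodup
  simp only [List.nodup_cons, List.mem_cons, not_or, List.not_mem_nil] at hnd
  have xa₁ : x a₁ = 7 / 10 := by grind
  have xb₁ : x b₁ = 7 / 10 := by grind
  have xa₂ : x a₂ = θ / 6 - 1 / 15 := by grind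
  have xa₃ : x a₃ = θ / 6 - 1 / 15 := by grind
  have xb₂ : x b₂ = θ / 6 - 1 / 15 := by grind
  have xb₃ : x b₃ = θ / 6 - 1 / 15 := by grind
  have xc₂ : x c₂ = θ / 6 + 2 / 15 := by grind
  have xc₃ : x c₃ = θ / 6 + 2 / 15 := by grind
  have xk : ∀ v, v ∉ [a₁, b₁, a₂, a₃, b₂, b₃, c₂, c₃] → x v = 1 := by
    intro v hv
    simp only [List.mem_cons, not_or, List.not_mem_nil] at hv
    simp [hx, hv]
  have hpos : ∀ v, 0 < x v := by
    intro v
    by_cases hv : v ∈ [a₁, b₁, a₂, a₃, b₂, b₃, c₂, c₃]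
    · simp only [List.mem_cons, List.not_mem_nil, or_false] at hv
      rcases hv with rfl | rfl | rfl | rfl | rfl | rfl | rfl | rfl <;> linarith
    · simp [xk v hv]
  clear_value x
  clear hx
  have out : ∀ (v : V) (l : List V), l.Nodup → (∀ w ∈ l, v = w ∨ H.Adj v w) →
      n - 3 / 5 + 4 * (θ / 6 - 16 / 15) + 2 * (θ / 6 - 13 / 15) - (l.map x).sum ≤ θ * x v →
      ∑ w, (if Hᶜ.Adj v w then x w else 0) ≤ θ * x v := by
    intro v l hl h1 h2
    refine (sum_ite_le_sum_sub (fun v => (hpos v).le) hl fun w hw h3 => ?_).trans (hsum ▸ h2)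
    rw [compl_adj] at h3
    exact (h1 w hw).elim h3.1 h3.2
  have ins : ∀ (v : V) (l : List V), (∀ w, w ≠ v → ¬ H.Adj v w → w ∈ l) →
      (l.map x).sum ≤ θ * x v → ∑ w, (if Hᶜ.Adj v w then x w else 0) ≤ θ * x v := by
    intro v l h1 h2
    refine (sum_ite_le_sum_map (fun v => (hpos v).le) fun w h3 => ?_).trans h2
    rw [compl_adj] at h3
    exact h1 w h3.1.symm h3.2
  have hkin : ∀ k ∈ K, ∀ w, w ≠ k → ¬ H.Adj k w → w ∈ [a₂, a₃, b₂, b₃, c₂, c₃] :=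
    fun k hk w hw hkw => (h.notMem_iff w).1 fun hw' => hkw (hK k hk w hw' hw.symm)
  have : Nonempty V := ⟨a₁⟩
  refine adjSpectralRadius_le _ hpos fun v => ?_
  by_cases hv : v ∈ [a₁, b₁, a₂, a₃, b₂, b₃, c₂, c₃]
  swap
  · refine ins v [a₂, a₃, b₂, b₃, c₂, c₃] (hkin v ?_) ?_
    · by_contra hvK
      exact hv (List.mem_cons_of_mem _ (List.mem_cons_of_mem _ ((h.notMem_iff v).1 hvK)))
    · simp only [List.map_cons, List.map_nil, List.sum_cons, List.sum_nil, xk v hv, xa₂, xa₃,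
        xb₂, xb₃, xc₂, xc₃]
      linarith
  simp only [List.mem_cons, List.not_mem_nil, or_false] at hv
  rcases hv with e | e | e | e | e | e | e | e <;> subst v
  · refine ins _ [b₂, b₃, c₂, c₃] (fun w hw h' => ?_) ?_
    · have hw' := hkin _ h.mem_a w hw h'
      have h₁₂ := h.adj_a₁₂
      have h₁₃ := h.adj_a₁₃
      clear hnd out ins hpos
      grind
    · simp only [List.map_cons, List.map_nil, List.sum_cons, List.sum_nil, xa₁, xb₂, xb₃, xc₂, xc₃]
      linarith
  · refine ins _ [a₂, a₃, c₂, c₃] (fun w hw h' => ?_) ?_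
    · have hw' := hkin _ h.mem_b w hw h'
      have h₁₂ := h.adj_b₁₂
      have h₁₃ := h.adj_b₁₃
      clear hnd out ins hpos
      grind
    · simp only [List.map_cons, List.map_nil, List.sum_cons, List.sum_nil, xb₁, xa₂, xa₃, xc₂, xc₃]
      linarith
  · refine out _ [a₂, a₁, a₃, b₂, c₂] (by grind) (fun w hw => ?_) ?_
    · simp only [List.mem_cons, List.not_mem_nil, or_false] at hw
      rcases hw with e | e | e | e | e <;> subst w <;>
        simp [h.adj_a₁₂.symm, h.adj_a₂₃, h₂, h.adj_ac₂]
    · simp only [List.map_cons, List.map_nil, List.sum_cons, List.sum_nil, xa₂, xa₁, xa₃, xb₂, xc₂]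
      linarith
  · refine out _ [a₃, a₁, a₂, b₃, c₃] (by grind) (fun w hw => ?_) ?_
    · simp only [List.mem_cons, List.not_mem_nil, or_false] at hw
      rcases hw with e | e | e | e | e <;> subst w <;>
        simp [h.adj_a₁₃.symm, h.adj_a₂₃.symm, h₃, h.adj_ac₃]
    · simp only [List.map_cons, List.map_nil, List.sum_cons, List.sum_nil, xa₃, xa₁, xa₂, xb₃, xc₃]
      linarith
  · refine out _ [b₂, b₁, b₃, a₂, c₂] (by grind) (fun w hw => ?_) ?_
    · simp only [List.mem_cons, List.not_mem_nil, or_false] at hw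
      rcases hw with e | e | e | e | e <;> subst w <;>
        simp [h.adj_b₁₂.symm, h.adj_b₂₃, h₂.symm, h.adj_bc₂]
    · simp only [List.map_cons, List.map_nil, List.sum_cons, List.sum_nil, xb₂, xb₁, xb₃, xa₂, xc₂]
      linarith
  · refine out _ [b₃, b₁, b₂, a₃, c₃] (by grind) (fun w hw => ?_) ?_
    · simp only [List.mem_cons, List.not_mem_nil, or_false] at hw
      rcases hw with e | e | e | e | e <;> subst w <;>
        simp [h.adj_b₁₃.symm, h.adj_b₂₃.symm, h₃.symm, h.adj_bc₃]
    · simp only [List.map_cons, List.map_nil, List.sum_cons, List.sum_nil, xb₃, xb₁, xb₂, xa₃, xc₃]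
      linarith
  · refine out _ [c₂, a₂, b₂] (by grind) (fun w hw => ?_) ?_
    · simp only [List.mem_cons, List.not_mem_nil, or_false] at hw
      rcases hw with e | e | e <;> subst w <;> simp [h.adj_ac₂.symm, h.adj_bc₂.symm]
    · simp only [List.map_cons, List.map_nil, List.sum_cons, List.sum_nil, xc₂, xa₂, xb₂]
      linarith
  · refine out _ [c₃, a₃, b₃] (by grind) (fun w hw => ?_) ?_
    · simp only [List.mem_cons, List.not_mem_nil, or_false] at hw
      rcases hw with e | e | e <;> subst w <;> simp [h.adj_ac₃.symm, h.adj_bc₃.symm]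
    · simp only [List.map_cons, List.map_nil, List.sum_cons, List.sum_nil, xc₃, xa₃, xb₃]
      linarith

end Bounds

section Bounds

variable {V : Type*} [Fintype V] [DecidableEq V] {G H : SimpleGraph V} {K : Set V}
  {a₁ a₂ a₃ b₁ b₂ b₃ c₁ c₂ c₃ : V} {n : ℕ} {θ : ℝ}

omit [Fintype V] [DecidableEq V] in
lemma EPType.ne_and_not_adj [Finite V] (h : EPType H K a₁ a₂ a₃ b₁ b₂ b₃ c₁ c₂ c₃)
    (hK : CliqueLike H K) (hH : ¬ HamList H) :
    ∀ w ∈ [b₂, b₃, c₂, c₃], a₁ ≠ w ∧ ¬ H.Adj w a₁ := by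
  have hnd := h.nodup
  simp only [List.nodup_cons, List.mem_cons, not_or, List.not_mem_nil] at hnd
  have nb₂ : H.Adj b₂ a₁ → a₁ ∈ [a₂, c₂, b₁, b₃] := h.swap₁₂.eq_of_adj_b hK hH
  have nb₃ : H.Adj b₃ a₁ → a₁ ∈ [a₃, c₃, b₁, b₂] := h.swap₂₃.swap₁₂.eq_of_adj_b hK hH
  have nc₂ : H.Adj c₂ a₁ → a₁ ∈ [a₂, b₂] := h.swap₁₂.eq_of_adj_c hK hH
  have nc₃ : H.Adj c₃ a₁ → a₁ ∈ [a₃, b₃] := h.swap₂₃.swap₁₂.eq_of_adj_c hK hH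
  simp only [List.mem_cons, hnd, List.not_mem_nil, or_self, imp_false] at nb₂ nb₃ nc₂ nc₃
  simp [*]

omit [Fintype V] [DecidableEq V] in
lemma EPType.ne_and_not_adj_of_notMem [Finite V] (h : EPType H K a₁ a₂ a₃ b₁ b₂ b₃ c₁ c₂ c₃)
    (hK : CliqueLike H K) (hH : ¬ HamList H) {v : V}
    (hv : v ∉ [a₁, a₂, a₃, b₁, b₂, b₃, c₁, c₂, c₃]) :
    ∀ w ∈ [b₁, b₂, b₃, c₁, c₂, c₃], v ≠ w ∧ ¬ H.Adj w v := by
  simp only [List.mem_cons, not_or, List.not_mem_nil] at hv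
  have nb₁ : H.Adj b₁ v → v ∈ [a₁, c₁, b₂, b₃] := h.eq_of_adj_b hK hH
  have nb₂ : H.Adj b₂ v → v ∈ [a₂, c₂, b₁, b₃] := h.swap₁₂.eq_of_adj_b hK hH
  have nb₃ : H.Adj b₃ v → v ∈ [a₃, c₃, b₁, b₂] := h.swap₂₃.swap₁₂.eq_of_adj_b hK hH
  have nc₁ : H.Adj c₁ v → v ∈ [a₁, b₁] := h.eq_of_adj_c hK hH
  have nc₂ : H.Adj c₂ v → v ∈ [a₂, b₂] := h.swap₁₂.eq_of_adj_c hK hH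
  have nc₃ : H.Adj c₃ v → v ∈ [a₃, b₃] := h.swap₂₃.swap₁₂.eq_of_adj_c hK hH
  simp only [List.mem_cons, hv, List.not_mem_nil, or_self, imp_false] at nb₁ nb₂ nb₃ nc₁ nc₂ nc₃
  simp [*]

theorem EPType.lt_adjSpectralRadius_compl (h : EPType H K a₁ a₂ a₃ b₁ b₂ b₃ c₁ c₂ c₃)
    (hK : CliqueLike H K) (hH : ¬ HamList H) (hG : G ≤ H) (hcard : Fintype.card V = n)
    (hθ : 36 ≤ θ) (hθn : θ ^ 2 = 6 * (n - 6) + 12 / 5 * θ) : θ < adjSpectralRadius Gᶜ := by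
  classical
  set x : V → ℝ := fun v => 1 + (if v = a₁ then -2 / 5 else 0) + (if v = a₂ then -2 / 5 else 0) +
    (if v = a₃ then -2 / 5 else 0) + (if v = b₁ then θ / 6 - 7 / 6 else 0) +
    (if v = b₂ then θ / 6 - 7 / 6 else 0) + (if v = b₃ then θ / 6 - 7 / 6 else 0) +
    (if v = c₁ then θ / 6 - 5 / 6 else 0) + (if v = c₂ then θ / 6 - 5 / 6 else 0) +
    (if v = c₃ then θ / 6 - 5 / 6 else 0) with hx
  have hsum : ∑ v, x v = n - 6 / 5 + 3 * (θ / 6 - 7 / 6) + 3 * (θ / 6 - 5 / 6) := by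
    simp only [hx, Finset.sum_add_distrib, Finset.sum_ite_eq', Finset.mem_univ, if_true]
    simp [hcard]
    ring
  have hnd := h.nodup
  simp only [List.nodup_cons, List.mem_cons, not_or, List.not_mem_nil] at hnd
  have xa₁ : x a₁ = 3 / 5 := by grind
  have xa₂ : x a₂ = 3 / 5 := by grind
  have xa₃ : x a₃ = 3 / 5 := by grind
  have xb₁ : x b₁ = θ / 6 - 1 / 6 := by grind
  have xb₂ : x b₂ = θ / 6 - 1 / 6 := by grind
  have xb₃ : x b₃ = θ / 6 - 1 / 6 := by grind
  have xc₁ : x c₁ = θ / 6 + 1 / 6 := by grind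
  have xc₂ : x c₂ = θ / 6 + 1 / 6 := by grind
  have xc₃ : x c₃ = θ / 6 + 1 / 6 := by grind
  have xk : ∀ v, v ∉ [a₁, a₂, a₃, b₁, b₂, b₃, c₁, c₂, c₃] → x v = 1 := by
    intro v hv
    simp only [List.mem_cons, not_or, List.not_mem_nil] at hv
    simp [hx, hv]
  have hpos : ∀ v, 0 < x v := by
    intro v
    by_cases hv : v ∈ [a₁, a₂, a₃, b₁, b₂, b₃, c₁, c₂, c₃]
    · simp only [List.mem_cons, List.not_mem_nil, or_false] at hv
      rcases hv with rfl | rfl | rfl | rfl | rfl | rfl | rfl | rfl | rfl <;> linarith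
    · simp [xk v hv]
  clear_value x
  clear hx
  have out : ∀ (v : V) (l : List V), (∀ w, H.Adj v w → w ∈ l) →
      θ * x v ≤ n - 6 / 5 + 3 * (θ / 6 - 7 / 6) + 3 * (θ / 6 - 5 / 6) - ((v :: l).map x).sum →
      θ * x v ≤ ∑ w, (if Gᶜ.Adj v w then x w else 0) := by
    intro v l h1 h2
    refine (hsum ▸ h2).trans (sum_sub_le_sum_ite (fun v => (hpos v).le) fun w h3 => ?_)
    rw [compl_adj, not_and, not_not] at h3
    by_cases hvw : v = w
    · exact hvw ▸ List.mem_cons_self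
    · exact List.mem_cons_of_mem _ (h1 w (hG (h3 hvw)))
  have ins : ∀ (v : V) (l : List V), l.Nodup → (∀ w ∈ l, v ≠ w ∧ ¬ H.Adj w v) →
      (l.map x).sum ≤ ∑ w, (if Gᶜ.Adj v w then x w else 0) := by
    intro v l hl h1
    refine sum_map_le_sum_ite (fun v => (hpos v).le) hl fun w hw => ?_
    exact (compl_adj _ _ _).2 ⟨(h1 w hw).1, fun h2 => (h1 w hw).2 (hG h2).symm⟩
  have nb₁ : ∀ v, H.Adj b₁ v → v ∈ [a₁, c₁, b₂, b₃] := fun v => h.eq_of_adj_b hK hH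
  have nb₂ : ∀ v, H.Adj b₂ v → v ∈ [a₂, c₂, b₁, b₃] := fun v => h.swap₁₂.eq_of_adj_b hK hH
  have nb₃ : ∀ v, H.Adj b₃ v → v ∈ [a₃, c₃, b₁, b₂] := fun v =>
    h.swap₂₃.swap₁₂.eq_of_adj_b hK hH
  have nc₁ : ∀ v, H.Adj c₁ v → v ∈ [a₁, b₁] := fun v => h.eq_of_adj_c hK hH
  have nc₂ : ∀ v, H.Adj c₂ v → v ∈ [a₂, b₂] := fun v => h.swap₁₂.eq_of_adj_c hK hH
  have nc₃ : ∀ v, H.Adj c₃ v → v ∈ [a₃, b₃] := fun v => h.swap₂₃.swap₁₂.eq_of_adj_c hK hH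
  have sa₁ : x b₂ + (x b₃ + (x c₂ + (x c₃ + 0))) ≤ ∑ w, (if Gᶜ.Adj a₁ w then x w else 0) :=
    ins a₁ [b₂, b₃, c₂, c₃] (by grind) (h.ne_and_not_adj hK hH)
  refine lt_adjSpectralRadius _ hpos (fun v => ?_) ⟨a₁, lt_of_lt_of_le (by rw [xa₁]; linarith) sa₁⟩
  by_cases hv : v ∈ [a₁, a₂, a₃, b₁, b₂, b₃, c₁, c₂, c₃]
  swap
  · refine le_trans ?_ (ins v [b₁, b₂, b₃, c₁, c₂, c₃] (by grind)
      (h.ne_and_not_adj_of_notMem hK hH hv))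
    simp only [List.map_cons, List.map_nil, List.sum_cons, List.sum_nil, xk v hv, xb₁, xb₂, xb₃,
      xc₁, xc₂, xc₃]
    linarith
  simp only [List.mem_cons, List.not_mem_nil, or_false] at hv
  rcases hv with e | e | e | e | e | e | e | e | e <;> subst v
  · rw [xa₁]
    linarith
  · refine le_trans ?_ (ins a₂ [b₁, b₃, c₁, c₃] (by grind) (h.swap₁₂.ne_and_not_adj hK hH))
    simp only [List.map_cons, List.map_nil, List.sum_cons, List.sum_nil, xa₂, xb₁, xb₃, xc₁, xc₃]
    linarith
  · refine le_trans ?_ (ins a₃ [b₁, b₂, c₁, c₂] (by grind)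
      (h.swap₂₃.swap₁₂.ne_and_not_adj hK hH))
    simp only [List.map_cons, List.map_nil, List.sum_cons, List.sum_nil, xa₃, xb₁, xb₂, xc₁, xc₂]
    linarith
  · refine out _ _ nb₁ ?_
    simp only [List.map_cons, List.map_nil, List.sum_cons, List.sum_nil, xb₁, xa₁, xc₁, xb₂, xb₃]
    linarith
  · refine out _ _ nb₂ ?_
    simp only [List.map_cons, List.map_nil, List.sum_cons, List.sum_nil, xb₂, xa₂, xc₂, xb₁, xb₃]
    linarith
  · refine out _ _ nb₃ ?_
    simp only [List.map_cons, List.map_nil, List.sum_cons, List.sum_nil, xb₃, xa₃, xc₃, xb₁, xb₂]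
    linarith
  · refine out _ _ nc₁ ?_
    simp only [List.map_cons, List.map_nil, List.sum_cons, List.sum_nil, xc₁, xa₁, xb₁]
    linarith
  · refine out _ _ nc₂ ?_
    simp only [List.map_cons, List.map_nil, List.sum_cons, List.sum_nil, xc₂, xa₂, xb₂]
    linarith
  · refine out _ _ nc₃ ?_
    simp only [List.map_cons, List.map_nil, List.sum_cons, List.sum_nil, xc₃, xa₃, xb₃]
    linarith

end Bounds

section EPgraphs

variable {n : ℕ}

lemma EP'graph_clique (u v : Fin n) (hu : u.val < n - 6) (hv : v.val < n - 6) (huv : u ≠ v) :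
    (EP'graph n).Adj u v := by
  rw [EP'graph, fromRel_adj]
  exact ⟨huv, Or.inl (Or.inl ⟨hu, hv⟩)⟩

lemma EP'graph_type (hn : 9 ≤ n) :
    EP'Type (EP'graph n) {i | i.val < n - 6} ⟨0, by omega⟩ ⟨n - 6, by omega⟩ ⟨n - 5, by omega⟩
      ⟨1, by omega⟩ ⟨n - 4, by omega⟩ ⟨n - 3, by omega⟩ ⟨n - 2, by omega⟩ ⟨n - 1, by omega⟩ where
  nodup := by simp; omega
  mem_a := by simp; omega
  mem_b := by simp; omega
  notMem_iff v := by simp [Fin.ext_iff]; omega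
  adj_a₁₂ := by simp [EP'graph]; omega
  adj_a₁₃ := by simp [EP'graph]; omega
  adj_a₂₃ := by simp [EP'graph]; omega
  adj_b₁₂ := by simp [EP'graph]; omega
  adj_b₁₃ := by simp [EP'graph]; omega
  adj_b₂₃ := by simp [EP'graph]; omega
  adj_ac₂ := by simp [EP'graph]; omega
  adj_ac₃ := by simp [EP'graph]; omega
  adj_bc₂ := by simp [EP'graph]; omega
  adj_bc₃ := by simp [EP'graph]; omega

lemma EP'graph_adj_ab₂ (hn : 9 ≤ n) :
    (EP'graph n).Adj ⟨n - 6, by omega⟩ ⟨n - 4, by omega⟩ := by simp [EP'graph]; omega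

lemma EP'graph_adj_ab₃ (hn : 9 ≤ n) :
    (EP'graph n).Adj ⟨n - 5, by omega⟩ ⟨n - 3, by omega⟩ := by simp [EP'graph]; omega

lemma EP'graph_compl_connected (hn : 9 ≤ n) : (EP'graph n)ᶜ.Connected := by
  have h1 : ∀ v : Fin n, v.val < n - 6 → (EP'graph n)ᶜ.Adj v ⟨n - 1, by omega⟩ := by
    intro v hv
    simp [EP'graph, Fin.ext_iff]
    omega
  have h2 : ∀ v : Fin n, n - 6 ≤ v.val → (EP'graph n)ᶜ.Adj v ⟨2, by omega⟩ := by
    intro v hv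
    simp [EP'graph, Fin.ext_iff]
    omega
  refine connected_iff_exists_forall_reachable _ |>.2 ⟨⟨n - 1, by omega⟩, fun v => ?_⟩
  by_cases hv : v.val < n - 6
  · exact (h1 v hv).reachable.symm
  · exact ((h2 v (by omega)).reachable.trans (h1 _ (by simp; omega)).reachable).symm

end EPgraphs

section Iso

variable {V : Type*} [Fintype V] {G H : SimpleGraph V} {K : Set V}
  {a₁ a₂ a₃ b₁ b₂ b₃ c₂ c₃ : V} {n : ℕ}

lemma exists_equiv_apply_eq {W : Type*} [Finite W] {m : ℕ} (hcard : Nat.card V = Nat.card W)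
    (p : Fin m ↪ V) (q : Fin m ↪ W) : ∃ f : V ≃ W, ∀ i, f (p i) = q i := by
  obtain ⟨e⟩ : Nonempty (V ≃ W) := Finite.card_eq.1 hcard
  have := Equiv.Perm.isMultiplyPretransitive W m
  obtain ⟨σ, hσ⟩ := MulAction.exists_smul_eq (Equiv.Perm W) (p.trans e.toEmbedding) q
  exact ⟨e.trans σ, fun i => DFunLike.congr_fun hσ i⟩

theorem EP'Type.exists_equiv (h : EP'Type H K a₁ a₂ a₃ b₁ b₂ b₃ c₂ c₃)
    (hK : CliqueLike H K) (hH : ¬ HamList H) (hcard : Fintype.card V = n) (hn : 9 ≤ n) :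
    ∃ f : V ≃ Fin n, ∀ u v, H.Adj u v → (EP'graph n).Adj (f u) (f v) := by
  have hT := EP'graph_type hn
  obtain ⟨f, hf⟩ := exists_equiv_apply_eq (V := V) (W := Fin n) (by simp [hcard])
    ⟨_, List.nodup_iff_injective_get.1 h.nodup⟩ ⟨_, List.nodup_iff_injective_get.1 hT.nodup⟩
  have fa₁ := hf ⟨0, by simp⟩
  have fb₁ := hf ⟨1, by simp⟩
  have fa₂ := hf ⟨2, by simp⟩
  have fa₃ := hf ⟨3, by simp⟩
  have fb₂ := hf ⟨4, by simp⟩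
  have fb₃ := hf ⟨5, by simp⟩
  have fc₂ := hf ⟨6, by simp⟩
  have fc₃ := hf ⟨7, by simp⟩
  simp at fa₁ fb₁ fa₂ fa₃ fb₂ fb₃ fc₂ fc₃
  clear hf
  have hfK : ∀ v, v ∈ K ↔ (f v).val < n - 6 := by
    intro v
    have h1 := (h.notMem_iff v).trans (iff_of_eq ?_) |>.trans (hT.notMem_iff (f v)).symm
    · exact not_iff_not.1 h1
    · simp only [List.mem_cons, List.not_mem_nil, ← fa₂, ← fa₃, ← fb₂, ← fb₃, ← fc₂, ← fc₃,
        f.apply_eq_iff_eq]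
  have key : ∀ u v, u ∉ K → H.Adj u v → (EP'graph n).Adj (f u) (f v) := by
    intro u v hu huv
    have na₂ : ∀ v, H.Adj a₂ v → v ∈ [a₁, a₃, b₂, c₂] := fun v => h.eq_of_adj_a hK hH
    have na₃ : ∀ v, H.Adj a₃ v → v ∈ [a₁, a₂, b₃, c₃] := fun v => h.swap₂₃.eq_of_adj_a hK hH
    have nb₂ : ∀ v, H.Adj b₂ v → v ∈ [b₁, b₃, a₂, c₂] := fun v => h.swap.eq_of_adj_a hK hH
    have nb₃ : ∀ v, H.Adj b₃ v → v ∈ [b₁, b₂, a₃, c₃] := fun v => h.swap.swap₂₃.eq_of_adj_a hK hH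
    have nc₂ : ∀ v, H.Adj c₂ v → v ∈ [a₂, b₂] := fun v => h.eq_of_adj_c hK hH
    have nc₃ : ∀ v, H.Adj c₃ v → v ∈ [a₃, b₃] := fun v => h.swap₂₃.eq_of_adj_c hK hH
    have hu' := (h.notMem_iff u).1 hu
    have t₂ := EP'graph_adj_ab₂ hn
    have t₃ := EP'graph_adj_ab₃ hn
    simp only [List.mem_cons, List.not_mem_nil, or_false] at hu' na₂ na₃ nb₂ nb₃ nc₂ nc₃
    rcases hu' with e | e | e | e | e | e <;> subst u
    · rcases na₂ v huv with e | e | e | e <;> subst v <;>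
        simp [*, hT.adj_a₁₂.symm, hT.adj_a₂₃, hT.adj_ac₂]
    · rcases na₃ v huv with e | e | e | e <;> subst v <;>
        simp [*, hT.adj_a₁₃.symm, hT.adj_a₂₃.symm, hT.adj_ac₃]
    · rcases nb₂ v huv with e | e | e | e <;> subst v <;>
        simp [*, hT.adj_b₁₂.symm, hT.adj_b₂₃, hT.adj_bc₂, t₂.symm]
    · rcases nb₃ v huv with e | e | e | e <;> subst v <;>
        simp [*, hT.adj_b₁₃.symm, hT.adj_b₂₃.symm, hT.adj_bc₃, t₃.symm]
    · rcases nc₂ v huv with e | e <;> subst v <;>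
        simp [*, hT.adj_ac₂.symm, hT.adj_bc₂.symm]
    · rcases nc₃ v huv with e | e <;> subst v <;>
        simp [*, hT.adj_ac₃.symm, hT.adj_bc₃.symm]
  refine ⟨f, fun u v huv => ?_⟩
  by_cases hu : u ∈ K
  · by_cases hv : v ∈ K
    · exact EP'graph_clique _ _ ((hfK u).1 hu) ((hfK v).1 hv) (f.injective.ne huv.ne)
    · exact (key v u hv huv.symm).symm
  · exact key u v hu huv

end Iso

section Closing

variable {V : Type*} {G : SimpleGraph V} {K : Set V}

lemma le_addClique : G ≤ addClique G K := fun _ _ h => Or.inl h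

lemma addClique_adj_of_notMem {u v : V} (hu : u ∉ K) : (addClique G K).Adj u v ↔ G.Adj u v :=
  ⟨fun h => h.resolve_right fun h' => hu h'.1, Or.inl⟩

lemma TwoConnected.two_le_degree [Fintype V] [DecidableEq V] [DecidableRel G.Adj]
    (h : TwoConnected G) (v : V) : 2 ≤ G.degree v := by
  by_contra! hv
  obtain ⟨x, hxv, hx⟩ : ∃ x, x ≠ v ∧ ∀ y, G.Adj v y → y = x := by
    by_cases hy : ∃ y, G.Adj v y
    · obtain ⟨y, hy⟩ := hy
      refine ⟨y, hy.ne', fun z hz => ?_⟩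
      rw [← card_neighborFinset_eq_degree, Nat.lt_succ_iff, Finset.card_le_one] at hv
      exact hv z (by simpa using hz) y (by simpa using hy)
    · have : Nontrivial V := Fintype.one_lt_card_iff_nontrivial.1 (by have := h.1; omega)
      obtain ⟨x, hx⟩ := exists_ne v
      exact ⟨x, hx, fun y hvy => (hy ⟨y, hvy⟩).elim⟩
  obtain ⟨w, hw⟩ : ∃ w, w ∉ ({v, x} : Finset V) := by
    by_contra! hcon
    have h1 := Finset.card_le_card (show Finset.univ ⊆ {v, x} from fun w _ => hcon w)
    have h2 := Finset.card_le_two (a := v) (b := x)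
    have h3 := h.1
    rw [Finset.card_univ] at h1
    omega
  simp only [Finset.mem_insert, Finset.mem_singleton, not_or] at hw
  have : Nontrivial ({x}ᶜ : Set V) :=
    ⟨⟨⟨v, hxv.symm⟩, ⟨w, hw.2⟩, fun e => hw.1 (congrArg Subtype.val e).symm⟩⟩
  obtain ⟨y, hy⟩ := (h.2 x).preconnected.exists_adj_of_nontrivial ⟨v, hxv.symm⟩
  exact y.2 (hx _ hy)

lemma ClawFree.adj_or_adj_or_adj (h : ClawFree G) {v a b c : V} (ha : G.Adj v a)
    (hb : G.Adj v b) (hc : G.Adj v c) (hab : a ≠ b) (hac : a ≠ c) (hbc : b ≠ c) :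
    G.Adj a b ∨ G.Adj a c ∨ G.Adj b c := by
  by_contra! hcon
  exact h ⟨v, a, b, c, hab, hac, hbc, ha, hb, hc, hcon⟩

/-- In a claw-free graph, a vertex with two nonadjacent neighbours `s`, `t` has degree at most
`d(s) + d(t)`. -/
lemma ClawFree.degree_le [Fintype V] [DecidableRel G.Adj] (h : ClawFree G) {k s t : V}
    (hs : G.Adj k s) (ht : G.Adj k t) (hst : s ≠ t) (hnst : ¬ G.Adj s t) :
    G.degree k ≤ G.degree s + G.degree t := by
  classical
  have hsub : G.neighborFinset k ⊆
      insert s ((G.neighborFinset s).erase k) ∪ insert t ((G.neighborFinset t).erase k) := by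
    intro v hv
    rw [mem_neighborFinset] at hv
    by_cases hvs : v = s
    · simp [hvs]
    by_cases hvt : v = t
    · simp [hvt]
    rcases h.adj_or_adj_or_adj hs ht hv hst (Ne.symm hvs) (Ne.symm hvt) with h1 | h1 | h1
    · exact absurd h1 hnst
    · simp [h1, hv.ne']
    · simp [h1, hv.ne']
  have h1 := (Finset.card_le_card hsub).trans (Finset.card_union_le _ _)
  have h2 := Finset.card_insert_le s ((G.neighborFinset s).erase k)
  have h3 := Finset.card_insert_le t ((G.neighborFinset t).erase k)
  have h4 := Finset.card_erase_add_one (show k ∈ G.neighborFinset s by simpa using hs.symm)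
  have h5 := Finset.card_erase_add_one (show k ∈ G.neighborFinset t by simpa using ht.symm)
  simp only [card_neighborFinset_eq_degree] at h1 h4 h5
  omega

lemma ClawFree.cliqueLike_addClique [Fintype V] [DecidableRel G.Adj] (h : ClawFree G)
    (hgap : ∀ k ∈ K, ∀ s ∉ K, ∀ t ∉ K, s ≠ t → G.degree s + G.degree t < G.degree k)
    (hlen : ∀ l : List V, l.Nodup → (∀ v ∈ l, v ∉ K) → l.length ≤ 6) :
    CliqueLike (addClique G K) K := by
  have clique : ∀ u ∈ K, ∀ v ∈ K, u ≠ v → (addClique G K).Adj u v :=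
    fun u hu v hv huv => Or.inr ⟨hu, hv, huv⟩
  have clean : ∀ k ∈ K, ∀ s ∉ K, ∀ t ∉ K, (addClique G K).Adj k s → (addClique G K).Adj k t →
      s ≠ t → (addClique G K).Adj s t := by
    intro k hk s hs t ht hks hkt hst
    by_contra hcon
    rw [adj_comm, addClique_adj_of_notMem hs] at hks
    rw [adj_comm, addClique_adj_of_notMem ht] at hkt
    rw [addClique_adj_of_notMem hs] at hcon
    exact (hgap k hk s hs t ht hst).not_ge (h.degree_le hks.symm hkt.symm hst hcon)
  refine ⟨clique, clean, fun v a b c ha hb hc hab hac hbc => ?_, hlen⟩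
  by_cases hv : v ∈ K
  · have two : ∀ x y, (addClique G K).Adj v x → (addClique G K).Adj v y → x ≠ y →
        (x ∈ K ↔ y ∈ K) → (addClique G K).Adj x y := by
      intro x y hx hy hxy hiff
      by_cases hxK : x ∈ K
      · exact clique x hxK y (hiff.1 hxK) hxy
      · exact clean v hv x hxK y (fun h => hxK (hiff.2 h)) hx hy hxy
    have := two a b ha hb hab
    have := two a c ha hc hac
    have := two b c hb hc hbc
    tauto
  · rw [addClique_adj_of_notMem hv] at ha hb hc
    exact (h.adj_or_adj_or_adj ha hb hc hab hac hbc).imp (le_addClique ·)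
      (Or.imp (le_addClique ·) (le_addClique ·))

lemma sq_le_of_sq_eq {n : ℕ} (hn : 219 ≤ n) {θ : ℝ} (hθ : 0 ≤ θ)
    (hθn : θ ^ 2 = 6 * (n - 6) + 12 / 5 * θ) :
    36 ≤ θ ∧ 1000 * (n * θ ^ 2) ≤ 6408 * (n : ℝ) ^ 2 - 36000 * n := by
  have hn' : (219 : ℝ) ≤ n := by exact_mod_cast hn
  have h1 : θ ≤ 17 / 100 * n := by
    by_contra! hcon
    nlinarith
  exact ⟨by nlinarith, by rw [hθn]; nlinarith⟩

lemma exists_sq_eq (n : ℕ) (hn : 6 ≤ n) : ∃ θ : ℝ, 0 ≤ θ ∧ θ ^ 2 = 6 * (n - 6) + 12 / 5 * θ := by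
  have hn' : (6 : ℝ) ≤ n := by exact_mod_cast hn
  have h : (0 : ℝ) ≤ 36 / 25 + 6 * (n - 6) := by linarith
  refine ⟨6 / 5 + √(36 / 25 + 6 * (n - 6)), by positivity, ?_⟩
  linear_combination Real.sq_sqrt h

/-- A non-Hamiltonian graph whose complement has small spectral radius lies below a graph with the
skeleton `EPType` or `EP'Type`, which is obtained by completing the vertices of large degree. -/
lemma exists_cliqueLike [Fintype V] [DecidableEq V] {n : ℕ} {θ : ℝ} (hn : 219 ≤ n)
    (hcard : Fintype.card V = n) (h2conn : TwoConnected G) (hclaw : ClawFree G) (hθ : 0 ≤ θ)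
    (hθn : θ ^ 2 = 6 * (n - 6) + 12 / 5 * θ) (hmu : adjSpectralRadius Gᶜ ≤ θ)
    (hG : ¬ HamList G) :
    ∃ (H : SimpleGraph V) (K : Set V), G ≤ H ∧ CliqueLike H K ∧ ¬ HamList H ∧
      ((∃ a₁ a₂ a₃ b₁ b₂ b₃ c₁ c₂ c₃, EPType H K a₁ a₂ a₃ b₁ b₂ b₃ c₁ c₂ c₃) ∨
        ∃ a₁ a₂ a₃ b₁ b₂ b₃ c₂ c₃, EP'Type H K a₁ a₂ a₃ b₁ b₂ b₃ c₂ c₃) := by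
  classical
  obtain ⟨hθ', hsq⟩ := sq_le_of_sq_eq hn hθ hθn
  have h1 := sum_degree_sq_le Gᶜ (by linarith) hmu
  obtain ⟨S, hS, hpre, hcount, hgap⟩ := exists_small_set hcard hn (d := fun v => G.degree v)
    h2conn.two_le_degree (by
      have h2 : ∀ v, ((Gᶜ.degree v : ℕ) : ℝ) = ((n : ℤ) - 1 - (G.degree v : ℤ) : ℤ) := by
        intro v
        have := G.degree_lt_card_verts v
        rw [degree_compl, ← Int.cast_natCast]
        congr 1
        omega
      have h3 : ((1000 * ∑ v, ((n : ℤ) - 1 - G.degree v) ^ 2 : ℤ) : ℝ) ≤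
          ((6408 * (n : ℤ) ^ 2 - 36000 * (n : ℤ) : ℤ) : ℝ) := by
        push_cast at h2 ⊢
        simp only [h2, hcard] at h1
        linarith
      exact_mod_cast h3)
  set K : Set V := (↑S)ᶜ with hK
  have hmemK : ∀ v, v ∈ K ↔ v ∉ S := fun v => by simp [hK]
  have hCL : CliqueLike (addClique G K) K := by
    refine hclaw.cliqueLike_addClique (fun k hk s hs t ht hst => ?_) fun l hl h => ?_
    · simp only [hmemK, not_not] at hk hs ht
      exact hgap k hk s hs t ht hst
    · rw [← List.toFinset_card_of_nodup hl]
      refine (Finset.card_le_card fun v hv => ?_).trans hS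
      simpa [hmemK] using h v (by simpa using hv)
  have hH : ¬ HamList (addClique G K) := fun hH => hG <| by
    refine hamList_of_addClique (fun s hs k hk => ?_) (fun h hh hk => ?_) hH
    · simp only [hmemK, not_not] at hk hs
      exact hpre s hs k hk
    · obtain ⟨k, hk, hkh⟩ := hk
      exact hcount h (hcard ▸ hh) ⟨k, (hmemK k).1 hk, hkh⟩
  refine ⟨addClique G K, K, le_addClique, hCL, hH, hCL.exists_type (fun v => ?_) ?_ hH⟩
  · exact (h2conn.2 v).mono (comap_monotone _ le_addClique)
  · have : 1 < (Finset.univ \ S).card := by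
      have := Finset.le_card_sdiff S Finset.univ
      rw [Finset.card_univ] at this
      omega
    obtain ⟨u, hu, v, hv, huv⟩ := Finset.one_lt_card.1 this
    exact ⟨u, by simpa [hmemK] using hu, v, by simpa [hmemK] using hv, huv⟩

end Closing

theorem statement_3 {V : Type*} [Fintype V] [DecidableEq V] (G : SimpleGraph V) (n : ℕ)
    (hn : 219 ≤ n) (hcard : Fintype.card V = n)
    (h2conn : TwoConnected G) (hclaw : ClawFree G)
    (hmu : adjSpectralRadius Gᶜ ≤ adjSpectralRadius (EP'graph n)ᶜ) :
    G.IsHamiltonian ∨ Nonempty (G ≃g EP'graph n) := by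
  classical
  by_cases hG : HamList G
  · exact Or.inl (hG.isHamiltonian h2conn.1)
  right
  obtain ⟨θ, hθ, hθn⟩ := exists_sq_eq n (by omega)
  have hθ' := (sq_le_of_sq_eq hn hθ hθn).1
  have hle : adjSpectralRadius (EP'graph n)ᶜ ≤ θ :=
    (EP'graph_type (by omega)).adjSpectralRadius_compl_le
      (fun u hu v hv => EP'graph_clique u v hu hv) (EP'graph_adj_ab₂ (by omega))
      (EP'graph_adj_ab₃ (by omega)) (Fintype.card_fin n) hθ' hθn
  obtain ⟨H, K, hGH, hK, hH, ⟨a₁, a₂, a₃, b₁, b₂, b₃, c₁, c₂, c₃, h⟩ |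
      ⟨a₁, a₂, a₃, b₁, b₂, b₃, c₂, c₃, h⟩⟩ :=
    exists_cliqueLike hn hcard h2conn hclaw hθ hθn (hmu.trans hle) hG
  · exact absurd (hmu.trans hle) (h.lt_adjSpectralRadius_compl hK hH hGH hcard hθ' hθn).not_ge
  · obtain ⟨f, hf⟩ := h.exists_equiv hK hH hcard (by omega)
    refine ⟨⟨f, fun {u v} => ⟨fun huv => ?_, fun huv => hf u v (hGH huv)⟩⟩⟩
    by_contra hcon
    refine hmu.not_gt (adjSpectralRadius_lt_of_equiv _ (EP'graph_compl_connected (by omega)) f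
      (fun u v h' => ?_) ⟨u, v, ?_, ?_⟩)
    · rw [compl_adj] at h' ⊢
      exact ⟨ne_of_apply_ne f h'.1, fun h => h'.2 (hf u v (hGH h))⟩
    · rw [compl_adj]
      exact ⟨ne_of_apply_ne f huv.ne, hcon⟩
    · rw [compl_adj]
      exact fun h => h.2 huv
end

section
/- Let G be a 2-connected closed claw-free graph on n vertices. If there exist two nonadjacent vertices u and v of G with d(u) + d(v) ≥ n, then G is Hamiltonian. -/
open SimpleGraph

namespace SimpleGraph

variable {V : Type*} {G : SimpleGraph V}

/-- In a closed claw-free graph, adjacency is transitive inside every neighbourhood. -/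
theorem adj_trans_of_closed_of_clawFree (hclosed : IsClosedGraph G) (hclaw : ClawFree G)
    {c a b d : V} (ha : G.Adj c a) (hb : G.Adj c b) (hd : G.Adj c d)
    (hab : G.Adj a b) (hbd : G.Adj b d) (hne : a ≠ d) : G.Adj a d := by
  by_contra had
  refine hclosed c ⟨?_, a, d, ha, hd, hne, had⟩
  let H := G.induce (G.neighborSet c)
  have hba_reach : H.Reachable ⟨b, hb⟩ ⟨a, ha⟩ := Adj.reachable (G := H) hab.symm
  have hbd_reach : H.Reachable ⟨b, hb⟩ ⟨d, hd⟩ := Adj.reachable (G := H) hbd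
  refine connected_iff_exists_forall_reachable _ |>.mpr ⟨⟨b, hb⟩, fun ⟨w, hw⟩ => ?_⟩
  rcases eq_or_ne a w with rfl | haw
  · exact hba_reach
  rcases eq_or_ne d w with rfl | hdw
  · exact hbd_reach
  by_cases h1 : G.Adj a w
  · exact hba_reach.trans (Adj.reachable (G := H) h1)
  by_cases h2 : G.Adj d w
  · exact hbd_reach.trans (Adj.reachable (G := H) h2)
  exact (hclaw ⟨c, a, d, w, hne, haw, hdw, ha, hd, hw, had, h1, h2⟩).elim

theorem isChain_adj_cons_append {l r : List V} {p q : V} (hl : l.Pairwise G.Adj)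
    (hp : ∀ w ∈ l, G.Adj p w) (hq : ∀ w ∈ l, G.Adj w q) (hpq : G.Adj p q)
    (hr : (q :: r).IsChain G.Adj) : (p :: (l ++ q :: r)).IsChain G.Adj := by
  induction l generalizing p with
  | nil => exact hr.cons_cons hpq
  | cons a l ih =>
    rw [List.pairwise_cons] at hl
    exact (ih hl.2 hl.1 (fun w hw => hq w (List.mem_cons_of_mem _ hw))
      (hq a List.mem_cons_self)).cons_cons (hp a List.mem_cons_self)

theorem isHamiltonian_of_isChain [Fintype V] [DecidableEq V] {a : V} {l : List V}
    (hchain : (a :: (l ++ [a])).IsChain G.Adj) (hnodup : (l ++ [a]).Nodup)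
    (hmem : ∀ w, w ∈ l ++ [a]) (hlen : 2 ≤ l.length) : G.IsHamiltonian := by
  intro _
  let p : G.Walk a a :=
    (Walk.ofSupport _ (List.cons_ne_nil a (l ++ [a])) hchain).copy (by simp) (by simp)
  have hsupp : p.support = a :: (l ++ [a]) :=
    (Walk.support_copy ..).trans (Walk.support_ofSupport ..)
  have hplen : 3 ≤ p.length := by
    have := p.length_support
    rw [hsupp] at this
    simp at this
    omega
  have hnil : ¬ p.Nil := by
    rw [← Walk.length_eq_zero_iff]
    omega
  have htail : p.tail.support = l ++ [a] := by
    rw [Walk.support_tail_of_not_nil _ hnil, hsupp, List.tail_cons]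
  have hpath : p.tail.IsPath := by
    rw [Walk.isPath_def, htail]
    exact hnodup
  exact ⟨a, p, Walk.isCycle_iff_isPath_tail_and_le_length.mpr ⟨hpath, hplen⟩,
    hpath.isHamiltonian_of_mem (by simpa [htail] using hmem)⟩

end SimpleGraph

theorem statement_4 {V : Type*} [Fintype V] [DecidableEq V] (G : SimpleGraph V) [DecidableRel G.Adj]
    (h2conn : TwoConnected G) (hclosed : IsClosedGraph G) (hclaw : ClawFree G)
    (u v : V) (hne : u ≠ v) (hadj : ¬ G.Adj u v)
    (hdeg : G.degree u + G.degree v ≥ Fintype.card V) :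
    G.IsHamiltonian := by
  have htrans {c a b d : V} := @adj_trans_of_closed_of_clawFree V G hclosed hclaw c a b d
  -- A common neighbour of `u` and `v` is not adjacent to another one.
  have hindep : ∀ x w, G.Adj u x → G.Adj v x → G.Adj u w → G.Adj v w → ¬ G.Adj x w :=
    fun x w hux hvx huw hvw hxw => hadj (htrans hux.symm hxw hvx.symm huw hvw.symm hne)
  have hsub : G.neighborFinset u ∪ G.neighborFinset v ⊆ Finset.univ \ {u, v} := by
    intro w hw
    simp only [Finset.mem_union, mem_neighborFinset] at hw
    simp only [Finset.mem_sdiff, Finset.mem_univ, true_and, Finset.mem_insert,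
      Finset.mem_singleton]
    rintro (rfl | rfl)
    · exact hw.elim (G.loopless.irrefl _) fun h => hadj h.symm
    · exact hw.elim hadj (G.loopless.irrefl _)
  have hcompl : (Finset.univ \ {u, v} : Finset V).card + 2 = Fintype.card V := by
    have := Finset.card_sdiff_add_card_eq_card (Finset.subset_univ ({u, v} : Finset V))
    rwa [Finset.card_pair hne, Finset.card_univ] at this
  have hunion := Finset.card_union_add_card_inter (G.neighborFinset u) (G.neighborFinset v)
  rw [card_neighborFinset_eq_degree, card_neighborFinset_eq_degree] at hunion
  have hle := Finset.card_le_card hsub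
  obtain ⟨x, hx, y, hy, hxy⟩ := Finset.one_lt_card.mp
    (show 1 < (G.neighborFinset u ∩ G.neighborFinset v).card by omega)
  simp only [Finset.mem_inter, mem_neighborFinset] at hx hy
  obtain ⟨hux, hvx⟩ := hx
  obtain ⟨huy, hvy⟩ := hy
  have hnxy := hindep x y hux hvx huy hvy
  have hcover : ∀ c w, G.Adj c x → G.Adj c y → G.Adj c w → w ≠ x → w ≠ y → ¬ G.Adj w x →
      G.Adj w y := by
    intro c w hcx hcy hcw hwx hwy hnwx
    by_contra hnwy
    exact hclaw ⟨c, w, x, y, hwx, hwy, hxy, hcw, hcx, hcy, hnwx, hnwy, hnxy⟩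
  have hinter : G.neighborFinset u ∩ G.neighborFinset v ⊆ {x, y} := by
    intro w hw
    simp only [Finset.mem_inter, mem_neighborFinset] at hw
    simp only [Finset.mem_insert, Finset.mem_singleton]
    by_contra! h
    exact hindep w y hw.1 hw.2 huy hvy
      (hcover u w hux huy hw.1 h.1 h.2 (hindep w x hw.1 hw.2 hux hvx))
  have hinter_card := Finset.card_le_card hinter
  rw [Finset.card_pair hxy] at hinter_card
  have heq := Finset.eq_of_subset_of_card_le hsub (by omega)
  have hall : ∀ w, w = u ∨ w = v ∨ G.Adj u w ∨ G.Adj v w := by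
    intro w
    have := Finset.ext_iff.mp heq w
    simp only [Finset.mem_union, mem_neighborFinset, Finset.mem_sdiff, Finset.mem_univ, true_and,
      Finset.mem_insert, Finset.mem_singleton] at this
    tauto
  have hboth : ∀ w, G.Adj u w → G.Adj v w → w = x ∨ w = y := fun w h1 h2 => by
    simpa using hinter (Finset.mem_inter.mpr ⟨by simpa using h1, by simpa using h2⟩)
  let near (c : V) : Finset V := {w | G.Adj c w ∧ G.Adj w x}
  let far (c : V) : Finset V := {w | G.Adj c w ∧ ¬ G.Adj w x ∧ w ≠ x ∧ w ≠ y}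
  have hnear : ∀ c w, w ∈ (near c).toList ↔ G.Adj c w ∧ G.Adj w x := by simp [near]
  have hfar : ∀ c w, w ∈ (far c).toList ↔ G.Adj c w ∧ ¬ G.Adj w x ∧ w ≠ x ∧ w ≠ y := by
    simp [far]
  have hnear_clique : ∀ c, G.Adj c x → (near c).toList.Pairwise G.Adj := fun c hcx =>
    (Finset.nodup_toList _).imp_of_mem fun {a b} ha hb hab => by
      rw [hnear] at ha hb
      exact htrans ha.1 hcx hb.1 ha.2 hb.2.symm hab
  have hfar_adj : ∀ c, G.Adj c x → G.Adj c y → ∀ w ∈ (far c).toList, G.Adj w y := by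
    intro c hcx hcy w hw
    rw [hfar] at hw
    exact hcover c w hcx hcy hw.1 hw.2.2.1 hw.2.2.2 hw.2.1
  have hfar_clique : ∀ c, G.Adj c x → G.Adj c y → (far c).toList.Pairwise G.Adj :=
    fun c hcx hcy => (Finset.nodup_toList _).imp_of_mem fun {a b} ha hb hab =>
      htrans ((hfar c a).mp ha).1 hcy ((hfar c b).mp hb).1
        (hfar_adj c hcx hcy a ha) (hfar_adj c hcx hcy b hb).symm hab
  have hchain : (u :: ((near u).toList ++ x :: ((near v).toList ++ v :: ((far v).toList ++
      y :: ((far u).toList ++ [u]))))).IsChain G.Adj := by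
    refine isChain_adj_cons_append (hnear_clique u hux) (fun w hw => ((hnear u w).mp hw).1)
      (fun w hw => ((hnear u w).mp hw).2) hux ?_
    refine isChain_adj_cons_append (hnear_clique v hvx) (fun w hw => ((hnear v w).mp hw).2.symm)
      (fun w hw => ((hnear v w).mp hw).1.symm) hvx.symm ?_
    refine isChain_adj_cons_append (hfar_clique v hvx hvy) (fun w hw => ((hfar v w).mp hw).1)
      (hfar_adj v hvx hvy) hvy ?_
    exact isChain_adj_cons_append (hfar_clique u hux huy)
      (fun w hw => (hfar_adj u hux huy w hw).symm) (fun w hw => ((hfar u w).mp hw).1.symm)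
      huy.symm (List.isChain_singleton u)
  refine isHamiltonian_of_isChain (a := u) (l := (near u).toList ++ x :: ((near v).toList ++
    v :: ((far v).toList ++ y :: (far u).toList))) (by simpa using hchain) ?_ ?_ ?_
  · have hirr : ∀ w, ¬ G.Adj w w := G.loopless.irrefl
    have hvu : ¬ G.Adj v u := fun h => hadj h.symm
    have hyx : ¬ G.Adj y x := fun h => hnxy h.symm
    have h1 := (near u).nodup_toList
    have h2 := (near v).nodup_toList
    have h3 := (far u).nodup_toList
    have h4 := (far v).nodup_toList
    clear_value near far
    clear hchain hall hdeg hsub hunion hle heq hinter hinter_card hcompl htrans hcover hindep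
      hnear_clique hfar_clique hfar_adj hclosed hclaw h2conn
    simp only [List.nodup_append, List.nodup_cons, List.mem_append, List.mem_cons, hnear, hfar,
      List.nodup_nil, List.not_mem_nil, h1, h2, h3, h4]
    grind
  · intro w
    simp only [List.mem_append, List.mem_cons, hnear, hfar]
    have := hall w
    tauto
  · simp
    omega
end
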